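/- arXiv:1702.03355 — 4 statements merged into one kernel-verified Lean document; each statement's English description precedes it below -/
import Mathlib

section
/- Let A be an alphabet and let M, N ⊆ A^* × A^* be sets of pairs of words such that the languages Mδ_A^L = {(w1,w2)δ_A^L : (w1,w2) ∈ M} and Nδ_A^L = {(w1',w2')δ_A^L : (w1',w2') ∈ N} are regular over A(2,$). Suppose there exist constants C and C' such that ||w1|−|w2|| ≤ C for every (w1,w2) ∈ M and ||w1'|−|w2'|| ≤ C' for every (w1',w2') ∈ N. Then the language M⊙'N = {(w1w1', w2w2')δ_A^L : (w1,w2) ∈ M, (w1',w2') ∈ N} is regular over A(2,$). -/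
/-!  Common definitions, following the conventions of the paper
"Automaticity of one-relator semigroups with length less than or equal to three".

Words over an alphabet `α` are modelled as `List α`; the empty word is `[]`.
The padded alphabet `A(2,$)` is modelled inside `Option α × Option α`,
where `none` plays the role of the padding symbol `$` (the pair `(none, none)`
never occurs in a padded convolution). -/

/-- A regular set of words: one accepted by a DFA with finitely many states. -/
abbrev IsReg {α : Type*} (L : Set (List α)) : Prop :=
  Language.IsRegular (L : Language α)

/-- Right-padded convolution `(x,y)δᴿ`: align the two words letter by letter
from the left and pad the shorter one on the right with the padding symbol. -/
def padR {α : Type*} (x y : List α) : List (Option α × Option α) :=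
  (x.map some ++ List.replicate (y.length - x.length) none).zip
    (y.map some ++ List.replicate (x.length - y.length) none)

/-- Left-padded convolution `(x,y)δᴸ`: align the two words letter by letter
from the right and pad the shorter one on the left with the padding symbol. -/
def padL {α : Type*} (x y : List α) : List (Option α × Option α) :=
  (List.replicate (y.length - x.length) none ++ x.map some).zip
    (List.replicate (x.length - y.length) none ++ y.map some)

/-- One elementary rewriting step: replace a factor `u` by `v`
for some defining relation `(u, v) ∈ R` (in either direction via `Relation.EqvGen`). -/
def OneStep {α : Type*} (R : Set (List α × List α)) (x y : List α) : Prop :=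
  ∃ p u v s, (u, v) ∈ R ∧ x = p ++ u ++ s ∧ y = p ++ v ++ s

/-- Equality of two words in the semigroup `sgp⁺⟨α ∣ R⟩` (resp. the monoid
`sgp⟨α ∣ R⟩`): the congruence on words generated by the relations `R`. -/
def WordEq {α : Type*} (R : Set (List α × List α)) : List α → List α → Prop :=
  Relation.EqvGen (OneStep R)

/-- Expansion of a word over an abstract generating set `β` into a word over the
presentation alphabet `α`, where `g b` is a word representing the generator `b`. -/
def expandW {α β : Type*} (g : β → List α) (w : List β) : List α :=
  (w.map g).flatten

/-- `(g, L)` is an automatic structure for the semigroup `sgp⁺⟨α ∣ R⟩` with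
respect to the finite generating set indexed by `β`:  each generator `b` is the
element of the semigroup represented by the nonempty word `g b`, the language
`L ⊆ β⁺` is regular and maps onto the semigroup, and `L_ε^$` together with all
`L_b^$` (right multiplication, right padding) are regular. -/
structure SgpAutoStruct {α β : Type*} (R : Set (List α × List α))
    (g : β → List α) (L : Set (List β)) : Prop where
  gen_ne : ∀ b, g b ≠ []
  reg : IsReg L
  ne : ∀ w ∈ L, w ≠ []
  onto : ∀ w : List α, w ≠ [] → ∃ x ∈ L, WordEq R (expandW g x) w
  eq_reg : IsReg {p | ∃ x ∈ L, ∃ y ∈ L,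
      WordEq R (expandW g x) (expandW g y) ∧ p = padR x y}
  mul_reg : ∀ b : β, IsReg {p | ∃ x ∈ L, ∃ y ∈ L,
      WordEq R (expandW g x ++ g b) (expandW g y) ∧ p = padR x y}

/-- A prefix-automatic structure for `sgp⁺⟨α ∣ R⟩`: an automatic structure for
which moreover `L'_= = {(x,y)δᴿ : x ∈ L, y ∈ Pref(L), x = y in S}` is regular. -/
structure SgpPrefixAutoStruct {α β : Type*} (R : Set (List α × List α))
    (g : β → List α) (L : Set (List β)) extends SgpAutoStruct R g L : Prop where
  pre_reg : IsReg {p | ∃ x ∈ L, ∃ y : List β, (∃ z ∈ L, y <+: z) ∧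
      WordEq R (expandW g x) (expandW g y) ∧ p = padR x y}

/-- A biautomatic structure for the semigroup `sgp⁺⟨α ∣ R⟩`: the languages
`L_b^$`, `_bL^$`, `^$L_b` and `_b^$L` are regular for every `b ∈ β ∪ {ε}`. -/
structure SgpBiautoStruct {α β : Type*} (R : Set (List α × List α))
    (g : β → List α) (L : Set (List β)) : Prop where
  gen_ne : ∀ b, g b ≠ []
  reg : IsReg L
  ne : ∀ w ∈ L, w ≠ []
  onto : ∀ w : List α, w ≠ [] → ∃ x ∈ L, WordEq R (expandW g x) w
  eqR_reg : IsReg {p | ∃ x ∈ L, ∃ y ∈ L,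
      WordEq R (expandW g x) (expandW g y) ∧ p = padR x y}
  eqL_reg : IsReg {p | ∃ x ∈ L, ∃ y ∈ L,
      WordEq R (expandW g x) (expandW g y) ∧ p = padL x y}
  mulRR_reg : ∀ b : β, IsReg {p | ∃ x ∈ L, ∃ y ∈ L,
      WordEq R (expandW g x ++ g b) (expandW g y) ∧ p = padR x y}
  mulLR_reg : ∀ b : β, IsReg {p | ∃ x ∈ L, ∃ y ∈ L,
      WordEq R (g b ++ expandW g x) (expandW g y) ∧ p = padR x y}
  mulRL_reg : ∀ b : β, IsReg {p | ∃ x ∈ L, ∃ y ∈ L,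
      WordEq R (expandW g x ++ g b) (expandW g y) ∧ p = padL x y}
  mulLL_reg : ∀ b : β, IsReg {p | ∃ x ∈ L, ∃ y ∈ L,
      WordEq R (g b ++ expandW g x) (expandW g y) ∧ p = padL x y}

/-- The semigroup `sgp⁺⟨α ∣ R⟩` is automatic: it admits an automatic structure
over some finite generating set. -/
def SgpAutomatic {α : Type*} (R : Set (List α × List α)) : Prop :=
  ∃ (β : Type) (_ : Fintype β) (g : β → List α) (L : Set (List β)),
    SgpAutoStruct R g L

/-- The semigroup `sgp⁺⟨α ∣ R⟩` is prefix-automatic. -/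
def SgpPrefixAutomatic {α : Type*} (R : Set (List α × List α)) : Prop :=
  ∃ (β : Type) (_ : Fintype β) (g : β → List α) (L : Set (List β)),
    SgpPrefixAutoStruct R g L

/-- The semigroup `sgp⁺⟨α ∣ R⟩` is biautomatic. -/
def SgpBiautomatic {α : Type*} (R : Set (List α × List α)) : Prop :=
  ∃ (β : Type) (_ : Fintype β) (g : β → List α) (L : Set (List β)),
    SgpBiautoStruct R g L

/-- `(g, L)` is an automatic structure for the monoid `sgp⟨α ∣ R⟩` with respect
to a finite generating set indexed by `β`; generators may represent any element
of the monoid (in particular the identity, represented by the empty word). -/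
structure MonAutoStruct {α β : Type*} (R : Set (List α × List α))
    (g : β → List α) (L : Set (List β)) : Prop where
  reg : IsReg L
  ne : ∀ w ∈ L, w ≠ []
  onto : ∀ w : List α, ∃ x ∈ L, WordEq R (expandW g x) w
  eq_reg : IsReg {p | ∃ x ∈ L, ∃ y ∈ L,
      WordEq R (expandW g x) (expandW g y) ∧ p = padR x y}
  mul_reg : ∀ b : β, IsReg {p | ∃ x ∈ L, ∃ y ∈ L,
      WordEq R (expandW g x ++ g b) (expandW g y) ∧ p = padR x y}

/-- A prefix-automatic structure for the monoid `sgp⟨α ∣ R⟩`. -/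
structure MonPrefixAutoStruct {α β : Type*} (R : Set (List α × List α))
    (g : β → List α) (L : Set (List β)) extends MonAutoStruct R g L : Prop where
  pre_reg : IsReg {p | ∃ x ∈ L, ∃ y : List β, (∃ z ∈ L, y <+: z) ∧
      WordEq R (expandW g x) (expandW g y) ∧ p = padR x y}

/-- A biautomatic structure for the monoid `sgp⟨α ∣ R⟩`. -/
structure MonBiautoStruct {α β : Type*} (R : Set (List α × List α))
    (g : β → List α) (L : Set (List β)) : Prop where
  reg : IsReg L
  ne : ∀ w ∈ L, w ≠ []
  onto : ∀ w : List α, ∃ x ∈ L, WordEq R (expandW g x) w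
  eqR_reg : IsReg {p | ∃ x ∈ L, ∃ y ∈ L,
      WordEq R (expandW g x) (expandW g y) ∧ p = padR x y}
  eqL_reg : IsReg {p | ∃ x ∈ L, ∃ y ∈ L,
      WordEq R (expandW g x) (expandW g y) ∧ p = padL x y}
  mulRR_reg : ∀ b : β, IsReg {p | ∃ x ∈ L, ∃ y ∈ L,
      WordEq R (expandW g x ++ g b) (expandW g y) ∧ p = padR x y}
  mulLR_reg : ∀ b : β, IsReg {p | ∃ x ∈ L, ∃ y ∈ L,
      WordEq R (g b ++ expandW g x) (expandW g y) ∧ p = padR x y}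
  mulRL_reg : ∀ b : β, IsReg {p | ∃ x ∈ L, ∃ y ∈ L,
      WordEq R (expandW g x ++ g b) (expandW g y) ∧ p = padL x y}
  mulLL_reg : ∀ b : β, IsReg {p | ∃ x ∈ L, ∃ y ∈ L,
      WordEq R (g b ++ expandW g x) (expandW g y) ∧ p = padL x y}

/-- The monoid `sgp⟨α ∣ R⟩` is automatic. -/
def MonAutomatic {α : Type*} (R : Set (List α × List α)) : Prop :=
  ∃ (β : Type) (_ : Fintype β) (g : β → List α) (L : Set (List β)),
    MonAutoStruct R g L

/-- The monoid `sgp⟨α ∣ R⟩` is prefix-automatic. -/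
def MonPrefixAutomatic {α : Type*} (R : Set (List α × List α)) : Prop :=
  ∃ (β : Type) (_ : Fintype β) (g : β → List α) (L : Set (List β)),
    MonPrefixAutoStruct R g L

/-- The monoid `sgp⟨α ∣ R⟩` is biautomatic. -/
def MonBiautomatic {α : Type*} (R : Set (List α × List α)) : Prop :=
  ∃ (β : Type) (_ : Fintype β) (g : β → List α) (L : Set (List β)),
    MonBiautoStruct R g L

/-- The defining relations of `S¹ = sgp⁺⟨α, e ∣ R, ea = ae = a, ee = e⟩`,
the monoid obtained from `S = sgp⁺⟨α ∣ R⟩` by adjoining an identity element,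
presented as a semigroup over the alphabet `Option α` where `none` is the new
identity letter `e`. -/
def adjoinOne {α : Type*} (R : Set (List α × List α)) :
    Set (List (Option α) × List (Option α)) :=
  {q | ∃ p ∈ R, q = (p.1.map some, p.2.map some)} ∪
    {q | ∃ a : α, q = ([none, some a], [some a])} ∪
    {q | ∃ a : α, q = ([some a, none], [some a])} ∪
    {([none, none], [none])}

namespace Aux

open List

theorem reg_or {T : Type} {L1 L2 : Set (List T)} (h1 : IsReg L1) (h2 : IsReg L2) :
    IsReg {w | w ∈ L1 ∨ w ∈ L2} :=
  Language.IsRegular.add h1 h2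

theorem reg_congr {T : Type} {L1 L2 : Set (List T)} (h : IsReg L2)
    (e : ∀ w, w ∈ L1 ↔ w ∈ L2) : IsReg L1 := by
  have : L1 = L2 := Set.ext e
  rw [this]; exact h

theorem reg_union {T ι : Type} (s : Set ι) (hs : s.Finite) (f : ι → Set (List T))
    (h : ∀ i ∈ s, IsReg (f i)) : IsReg {w | ∃ i ∈ s, w ∈ f i} := by
  induction s, hs using Set.Finite.induction_on with
  | empty =>
    refine Language.IsRegular.of_finite_range_leftQuotient (Set.Finite.subset (Set.finite_singleton (∅ : Set (List T))) ?_)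
    rintro _ ⟨x, rfl⟩
    ext y
    change (∃ i ∈ (∅ : Set ι), _) ↔ False
    simp
  | @insert a s _ _ ih =>
    have h1 := reg_or (h a (by simp)) (ih (fun i hi => h i (by simp [hi])))
    refine reg_congr h1 (fun w => ?_)
    change (∃ i ∈ insert a s, w ∈ f i) ↔ (w ∈ f a ∨ ∃ i ∈ s, w ∈ f i)
    simp

theorem reg_lq {T : Type} (L : Language T) (h : L.IsRegular) (x : List T) :
    (L.leftQuotient x).IsRegular := by
  refine Language.IsRegular.of_finite_range_leftQuotient (h.finite_range_leftQuotient.subset ?_)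
  rintro _ ⟨y, rfl⟩
  exact ⟨x ++ y, L.leftQuotient_append x y⟩

theorem reg_mul {T : Type} (L1 L2 : Language T) (h1 : L1.IsRegular) (h2 : L2.IsRegular) :
    IsReg {w | ∃ u ∈ L1, ∃ v ∈ L2, w = u ++ v} := by
  refine Language.IsRegular.of_finite_range_leftQuotient
    (((h1.finite_range_leftQuotient.prod h2.finite_range_leftQuotient.finite_subsets).image
      (fun p : Language T × Set (Language T) =>
        ({w | (∃ u ∈ p.1, ∃ v ∈ L2, w = u ++ v) ∨ ∃ Q ∈ p.2, w ∈ Q} : Set (List T)))).subset ?_)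
  rintro _ ⟨x, rfl⟩
  refine ⟨(L1.leftQuotient x, {Q | ∃ u ∈ L1, ∃ v, x = u ++ v ∧ Q = L2.leftQuotient v}),
    ⟨⟨x, rfl⟩, ?_⟩, ?_⟩
  · rintro _ ⟨u, _, v, _, rfl⟩
    exact ⟨v, rfl⟩
  · ext y
    change ((∃ u ∈ L1.leftQuotient x, ∃ v ∈ L2, y = u ++ v) ∨ ∃ Q ∈ {Q | ∃ u ∈ L1, ∃ v, x = u ++ v ∧ Q = L2.leftQuotient v}, y ∈ Q) ↔ ∃ u ∈ L1, ∃ v ∈ L2, x ++ y = u ++ v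
    constructor
    · rintro (⟨u, hu, v, hv, rfl⟩ | ⟨_, ⟨u, hu, v, rfl, rfl⟩, hy⟩)
      · exact ⟨x ++ u, hu, v, hv, by simp⟩
      · exact ⟨u, hu, v ++ y, hy, by simp⟩
    · rintro ⟨u, hu, v, hv, h⟩
      rcases List.append_eq_append_iff.1 h with ⟨c, rfl, rfl⟩ | ⟨c, rfl, rfl⟩
      · exact Or.inl ⟨c, hu, v, hv, rfl⟩
      · exact Or.inr ⟨_, ⟨u, hu, c, rfl, rfl⟩, hv⟩

theorem reg_comap {T T' : Type} (f : T' → T) (L : Set (List T)) (h : IsReg L) :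
    IsReg {w | w.map f ∈ L} := by
  obtain ⟨σ, hσ, D, hD⟩ := h
  refine ⟨σ, hσ, D.comap f, ?_⟩
  rw [DFA.accepts_comap, hD]
  rfl

theorem reg_all {T : Type} (P : T → Prop) : IsReg {w : List T | ∀ a ∈ w, P a} := by
  refine Language.IsRegular.of_finite_range_leftQuotient
    ((Set.toFinite ({{w : List T | ∀ a ∈ w, P a}, ∅} : Set (Set (List T)))).subset ?_)
  rintro _ ⟨x, rfl⟩
  by_cases h : ∀ a ∈ x, P a
  · left
    ext y
    change (∀ a ∈ x ++ y, P a) ↔ ∀ a ∈ y, P a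
    simp only [List.mem_append]
    grind
  · right
    ext y
    change (∀ a ∈ x ++ y, P a) ↔ False
    simp only [List.mem_append]
    grind

variable {α : Type}

theorem ext_pairs {A B : Type} {u v : List (A × B)} (h1 : u.map Prod.fst = v.map Prod.fst)
    (h2 : u.map Prod.snd = v.map Prod.snd) : u = v := by
  rw [← List.zip_unzip u, ← List.zip_unzip v]
  simp only [List.unzip_fst, List.unzip_snd, h1, h2]

theorem padL_fst (x y : List α) : (padL x y).map Prod.fst =
    List.replicate (y.length - x.length) none ++ x.map some := by
  unfold padL
  rw [List.map_fst_zip]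
  simp; omega

theorem padL_snd (x y : List α) : (padL x y).map Prod.snd =
    List.replicate (x.length - y.length) none ++ y.map some := by
  unfold padL
  rw [List.map_snd_zip]
  simp; omega

theorem padL_swap (x y : List α) : (padL x y).map Prod.swap = padL y x := by
  apply ext_pairs
  · rw [padL_fst, List.map_map, ← padL_snd]; rfl
  · rw [padL_snd, List.map_map, ← padL_fst]; rfl

theorem padL_append (x y t t' : List α) (h : t.length = t'.length) :
    padL (x ++ t) (y ++ t') = padL x y ++ padL t t' := by
  apply ext_pairs
  · simp [padL_fst, h, Nat.add_sub_add_right]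
  · simp [padL_snd, h, Nat.add_sub_add_right]

theorem padL_inj {x y x' y' : List α} (h : padL x y = padL x' y') : x = x' ∧ y = y' := by
  have h1 := congrArg (fun w => (w.map Prod.fst).reduceOption) h
  have h2 := congrArg (fun w => (w.map Prod.snd).reduceOption) h
  simp only [padL_fst, padL_snd, List.reduceOption_append, List.reduceOption_replicate_none,
    List.nil_append] at h1 h2
  have key : ∀ l : List α, (l.map some).reduceOption = l := by
    intro l; simp [List.reduceOption]
  simpa [key] using And.intro h1 h2

/-- A word with no padding is the convolution of two words of equal length. -/
theorem exists_of_all (w : List (Option α × Option α))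
    (h : ∀ a ∈ w, a.1.isSome ∧ a.2.isSome) :
    ∃ t t' : List α, t.length = t'.length ∧ w = padL t t' := by
  induction w with
  | nil => exact ⟨[], [], rfl, rfl⟩
  | cons a w ih =>
    obtain ⟨t, t', hl, rfl⟩ := ih (fun b hb => h b (by simp [hb]))
    obtain ⟨⟨c, d⟩, ha⟩ : ∃ p : α × α, a = (some p.1, some p.2) := by
      have := h a (by simp)
      rcases a with ⟨_ | c, _ | d⟩ <;> simp at this
      exact ⟨(c, d), rfl⟩
    refine ⟨c :: t, d :: t', by simp [hl], ?_⟩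
    subst ha
    simp [padL, hl]

theorem all_of_eq (t t' : List α) (h : t.length = t'.length) :
    ∀ a ∈ padL t t', a.1.isSome ∧ a.2.isSome := by
  intro a ha
  have h1 : a.1 ∈ (padL t t').map Prod.fst := List.mem_map_of_mem ha
  have h2 : a.2 ∈ (padL t t').map Prod.snd := List.mem_map_of_mem ha
  rw [padL_fst] at h1
  rw [padL_snd] at h2
  simp [h] at h1 h2
  grind

/-- Shift the first components by one place. -/
def sh : Option α → List (Option α × Option α) → List (Option α × Option α)
  | _, [] => []
  | c, p :: w => (c, p.2) :: sh p.1 w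

/-- The pending first component after a shift. -/
def lst : Option α → List (Option α × Option α) → Option α
  | c, [] => c
  | _, p :: w => lst p.1 w

theorem sh_fst (c : Option α) (w : List (Option α × Option α)) :
    (sh c w).map Prod.fst ++ [lst c w] = c :: w.map Prod.fst := by
  induction w generalizing c with
  | nil => rfl
  | cons p w ih => simp [sh, lst, ih]

theorem sh_snd (c : Option α) (w : List (Option α × Option α)) :
    (sh c w).map Prod.snd = w.map Prod.snd := by
  induction w generalizing c with
  | nil => rfl
  | cons p w ih => simp [sh, ih]

theorem sh_iff (c e : Option α) (w z : List (Option α × Option α)) :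
    (sh c w = z ∧ lst c w = e) ↔
      (c :: w.map Prod.fst = z.map Prod.fst ++ [e] ∧ w.map Prod.snd = z.map Prod.snd) := by
  constructor
  · rintro ⟨rfl, rfl⟩
    exact ⟨(sh_fst c w).symm, (sh_snd c w).symm⟩
  · rintro ⟨h1, h2⟩
    rw [← sh_fst] at h1
    have h3 := List.append_inj' h1 rfl
    exact ⟨ext_pairs h3.1 (by rw [sh_snd, h2]), by simpa using h3.2⟩

/-- The one-letter-delay automaton. -/
def shDFA {σ : Type} (D : DFA (Option α × Option α) σ) (st : Option (Option (σ × Option α)))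
    (e : Option α) : DFA (Option α × Option α) (Option (Option (σ × Option α))) where
  step s p := match s, p with
    | none, _ => none
    | some none, (some c, none) => some (some (D.start, some c))
    | some none, _ => none
    | some (some (q, c)), p => some (some (D.step q (c, p.2), p.1))
  start := st
  accept := {s | ∃ q ∈ D.accept, s = some (some (q, e))}

theorem shDFA_live {σ : Type} (D : DFA (Option α × Option α) σ) (st e)
    (q : σ) (c : Option α) (w) :
    (shDFA D st e).evalFrom (some (some (q, c))) w =
      some (some (D.evalFrom q (sh c w), lst c w)) := by
  induction w generalizing q c with
  | nil => rfl
  | cons p w ih => rw [DFA.evalFrom_cons]; exact ih _ _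

theorem shDFA_dead {σ : Type} (D : DFA (Option α × Option α) σ) (st e) (w) :
    (shDFA D st e).evalFrom none w = none := by
  induction w with
  | nil => rfl
  | cons p w ih => rw [DFA.evalFrom_cons]; exact ih

theorem reg_sh2 [Fintype α] (L : Set (List (Option α × Option α))) (h : IsReg L) (e : Option α) :
    IsReg {w | sh none w ∈ L ∧ lst none w = e} := by
  obtain ⟨σ, hσ, D, rfl⟩ := h
  refine ⟨_, inferInstance, shDFA D (some (some (D.start, none))) e, ?_⟩
  ext w
  change (∃ q ∈ D.accept, (shDFA D (some (some (D.start, none))) e).evalFrom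
    (some (some (D.start, none))) w = some (some (q, e))) ↔ _
  rw [shDFA_live]
  change (∃ q ∈ D.accept, some (some (D.evalFrom D.start (sh none w), lst none w)) = some (some (q, e))) ↔ (D.evalFrom D.start (sh none w) ∈ D.accept ∧ lst none w = e)
  simp

theorem reg_sh1 [Fintype α] (L : Set (List (Option α × Option α))) (h : IsReg L) (e : Option α) :
    IsReg {w | ∃ c u, w = (some c, none) :: u ∧ sh (some c) u ∈ L ∧ lst (some c) u = e} := by
  obtain ⟨σ, hσ, D, rfl⟩ := h
  refine ⟨_, inferInstance, shDFA D (some none) e, ?_⟩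
  ext w
  change (∃ q ∈ D.accept, (shDFA D (some none) e).evalFrom (some none) w = some (some (q, e))) ↔
    ∃ c u, w = (some c, none) :: u ∧ D.evalFrom D.start (sh (some c) u) ∈ D.accept ∧ lst (some c) u = e
  rcases w with _ | ⟨⟨_ | c, _ | d⟩, w⟩
  · simp
  all_goals rw [DFA.evalFrom_cons]
  · change (∃ q ∈ D.accept, (shDFA D (some none) e).evalFrom none w = some (some (q, e))) ↔ _
    simp [shDFA_dead]
  · change (∃ q ∈ D.accept, (shDFA D (some none) e).evalFrom none w = some (some (q, e))) ↔ _
    simp [shDFA_dead]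
  · change (∃ q ∈ D.accept, (shDFA D (some none) e).evalFrom (some (some (D.start, some c))) w = some (some (q, e))) ↔ _
    rw [shDFA_live]
    simp
  · change (∃ q ∈ D.accept, (shDFA D (some none) e).evalFrom none w = some (some (q, e))) ↔ _
    simp [shDFA_dead]

theorem reg_letter [Fintype α] (M : Set (List α × List α))
    (hM : IsReg {p | ∃ q ∈ M, p = padL q.1 q.2}) (a : α) :
    IsReg {p | ∃ q ∈ M, p = padL (q.1 ++ [a]) q.2} := by
  have h := reg_or (reg_sh1 _ hM (some a)) (reg_sh2 _ hM (some a))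
  refine reg_congr h (fun w => ?_)
  change (∃ q ∈ M, w = padL (q.1 ++ [a]) q.2) ↔
    (∃ c u, w = (some c, none) :: u ∧ (∃ q ∈ M, sh (some c) u = padL q.1 q.2) ∧ lst (some c) u = some a)
    ∨ ((∃ q ∈ M, sh none w = padL q.1 q.2) ∧ lst none w = some a)
  constructor
  · rintro ⟨q, hq, rfl⟩
    by_cases hl : q.1.length < q.2.length
    · right
      have := (sh_iff none (some a) (padL (q.1 ++ [a]) q.2) (padL q.1 q.2)).2 (by
        simp only [padL_fst, padL_snd]
        have e1 : q.2.length - q.1.length = (q.2.length - (q.1 ++ [a]).length) + 1 := by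
          simp; omega
        have e2 : q.1.length - q.2.length = 0 := by omega
        have e3 : (q.1 ++ [a]).length - q.2.length = 0 := by simp; omega
        rw [e1, e2, e3]
        simp [List.replicate_succ])
      exact ⟨⟨q, hq, this.1⟩, this.2⟩
    · left
      have e1 : q.2.length - (q.1 ++ [a]).length = 0 := by simp; omega
      have e2 : (q.1 ++ [a]).length - q.2.length = (q.1.length - q.2.length) + 1 := by
        simp; omega
      have e3 : q.2.length - q.1.length = 0 := by omega
      have f1 := padL_fst (q.1 ++ [a]) q.2
      have f2 := padL_snd (q.1 ++ [a]) q.2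
      rw [e1] at f1
      rw [e2, List.replicate_succ] at f2
      generalize padL (q.1 ++ [a]) q.2 = w at f1 f2
      rcases w with _ | ⟨⟨o1, o2⟩, u⟩
      · simp at f1
      obtain ⟨c, hc⟩ : ∃ c, o1 = some c := by
        rcases hx : q.1 with _ | ⟨b, x⟩ <;> rw [hx] at f1 <;> simp at f1
        · exact ⟨_, f1.1⟩
        · exact ⟨_, f1.1⟩
      subst hc
      simp at f2
      obtain ⟨rfl, f2⟩ := f2
      have := (sh_iff (some c) (some a) u (padL q.1 q.2)).2 (by
        simp only [padL_fst, padL_snd, e3]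
        refine ⟨by simpa using f1, by simpa using f2⟩)
      exact ⟨c, u, rfl, ⟨q, hq, this.1⟩, this.2⟩
  · rintro (⟨c, u, rfl, ⟨q, hq, h1⟩, h2⟩ | ⟨⟨q, hq, h1⟩, h2⟩)
    · obtain ⟨g1, g2⟩ := (sh_iff _ _ _ _).1 ⟨h1, h2⟩
      rw [padL_fst] at g1
      rw [padL_snd] at g2
      have e3 : q.2.length - q.1.length = 0 := by
        rcases hk : q.2.length - q.1.length with _ | k
        · rfl
        · rw [hk] at g1; simp [List.replicate_succ] at g1
      rw [e3] at g1
      refine ⟨q, hq, ext_pairs ?_ ?_⟩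
      · rw [padL_fst]
        have e1 : q.2.length - (q.1 ++ [a]).length = 0 := by simp; omega
        rw [e1]
        simpa using g1
      · rw [padL_snd]
        have e2 : (q.1 ++ [a]).length - q.2.length = (q.1.length - q.2.length) + 1 := by
          simp; omega
        rw [e2]
        simpa [List.replicate_succ] using g2
    · obtain ⟨g1, g2⟩ := (sh_iff _ _ _ _).1 ⟨h1, h2⟩
      rw [padL_fst] at g1
      rw [padL_snd] at g2
      obtain ⟨k, hk⟩ : ∃ k, q.2.length - q.1.length = k + 1 := by
        rcases hk : q.2.length - q.1.length with _ | k
        · rw [hk] at g1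
          rcases hx : q.1 with _ | ⟨b, x⟩ <;> rw [hx] at g1 <;> simp at g1
        · exact ⟨k, rfl⟩
      rw [hk] at g1
      refine ⟨q, hq, ext_pairs ?_ ?_⟩
      · rw [padL_fst]
        have e1 : q.2.length - (q.1 ++ [a]).length = k := by simp; omega
        rw [e1]
        simpa [List.replicate_succ] using g1
      · rw [padL_snd, g2]
        have e2 : (q.1 ++ [a]).length - q.2.length = 0 := by simp; omega
        have e4 : q.1.length - q.2.length = 0 := by omega
        rw [e2, e4]

theorem reg_word [Fintype α] (s : List α) (M : Set (List α × List α))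
    (hM : IsReg {p | ∃ q ∈ M, p = padL q.1 q.2}) :
    IsReg {p | ∃ q ∈ M, p = padL (q.1 ++ s) q.2} := by
  induction s generalizing M with
  | nil => simpa using hM
  | cons a s ih =>
    have h := ih {q | ∃ r ∈ M, q = (r.1 ++ [a], r.2)} (by
      convert reg_letter M hM a using 1
      ext p
      constructor
      · rintro ⟨_, ⟨r, hr, rfl⟩, rfl⟩
        exact ⟨r, hr, rfl⟩
      · rintro ⟨r, hr, rfl⟩
        exact ⟨_, ⟨r, hr, rfl⟩, rfl⟩)
    convert h using 1
    ext p
    constructor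
    · rintro ⟨r, hr, rfl⟩
      exact ⟨_, ⟨r, hr, rfl⟩, by simp⟩
    · rintro ⟨_, ⟨r, hr, rfl⟩, rfl⟩
      exact ⟨r, hr, by simp⟩

theorem reg_half [Fintype α] (M N : Set (List α × List α)) (C' : ℕ)
    (hM : IsReg {p | ∃ q ∈ M, p = padL q.1 q.2})
    (hN : IsReg {p | ∃ q ∈ N, p = padL q.1 q.2})
    (hNC : ∀ q ∈ N, ((q.1.length : ℤ) - (q.2.length : ℤ)).natAbs ≤ C') :
    IsReg {p | ∃ q ∈ M, ∃ r ∈ N, r.2.length ≤ r.1.length ∧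
      p = padL (q.1 ++ r.1) (q.2 ++ r.2)} := by
  have key := reg_union {s : List α | s.length ≤ C'} (List.finite_length_le α C') _
    (fun s _ => reg_mul _ _ (reg_word s M hM)
      (Language.IsRegular.inf (reg_all (fun a : Option α × Option α => a.1.isSome ∧ a.2.isSome))
        (reg_lq _ hN (padL s []))))
  convert key using 1
  ext w
  change _ ↔ ∃ s : List α, s.length ≤ C' ∧ ∃ u, (∃ q ∈ M, u = padL (q.1 ++ s) q.2) ∧
    ∃ v, ((∀ a ∈ v, a.1.isSome ∧ a.2.isSome) ∧ ∃ r ∈ N, padL s [] ++ v = padL r.1 r.2) ∧ w = u ++ v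
  constructor
  · rintro ⟨q, hq, ⟨r1, r2⟩, hr, hl, rfl⟩
    have hb := hNC _ hr
    simp only at hb hl
    have e := List.take_append_drop (r1.length - r2.length) r1
    have hs : (r1.take (r1.length - r2.length)).length = r1.length - r2.length := by simp
    have ht : (r1.drop (r1.length - r2.length)).length = r2.length := by simp; omega
    generalize r1.take (r1.length - r2.length) = s at e hs
    generalize r1.drop (r1.length - r2.length) = t at e ht
    subst e
    refine ⟨s, by omega, _, ⟨q, hq, rfl⟩, padL t r2, ⟨all_of_eq _ _ ht, _, hr, ?_⟩, ?_⟩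
    · exact (padL_append s [] t r2 ht).symm
    · rw [← padL_append _ _ _ _ ht]; simp
  · rintro ⟨s, hs, _, ⟨q, hq, rfl⟩, v, ⟨hv, ⟨r1, r2⟩, hr, hvr⟩, rfl⟩
    obtain ⟨t, t', hl, rfl⟩ := exists_of_all v hv
    rw [← padL_append _ _ _ _ hl] at hvr
    obtain ⟨rfl, rfl⟩ := padL_inj hvr
    refine ⟨q, hq, _, hr, by simp [hl], ?_⟩
    rw [← padL_append _ _ _ _ hl]; simp

theorem reg_swap (M : Set (List α × List α)) (hM : IsReg {p | ∃ q ∈ M, p = padL q.1 q.2}) :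
    IsReg {p | ∃ q ∈ {q : List α × List α | q.swap ∈ M}, p = padL q.1 q.2} := by
  convert reg_comap Prod.swap _ hM using 1
  ext w
  constructor
  · rintro ⟨q, hq, rfl⟩
    exact ⟨_, hq, padL_swap _ _⟩
  · rintro ⟨q, hq, h⟩
    refine ⟨q.swap, by simpa using hq, ?_⟩
    have := congrArg (List.map Prod.swap) h
    rw [padL_swap] at this
    simpa using this

end Aux

/-- if `Mδᴸ` and `Nδᴸ` are regular and the pairs in `M` and `N`
have length differences bounded by `C` and `C'` respectively, then
`M ⊙' N = {(w₁w₁', w₂w₂')δᴸ : (w₁,w₂) ∈ M, (w₁',w₂') ∈ N}` is regular. -/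
theorem statement_0 {α : Type} [Fintype α] (M N : Set (List α × List α)) (C C' : ℕ)
    (hM : IsReg {p | ∃ q ∈ M, p = padL q.1 q.2})
    (hN : IsReg {p | ∃ q ∈ N, p = padL q.1 q.2})
    (hMC : ∀ q ∈ M, ((q.1.length : ℤ) - (q.2.length : ℤ)).natAbs ≤ C)
    (hNC : ∀ q ∈ N, ((q.1.length : ℤ) - (q.2.length : ℤ)).natAbs ≤ C') :
    IsReg {p | ∃ q ∈ M, ∃ r ∈ N, p = padL (q.1 ++ r.1) (q.2 ++ r.2)} := by
  have h1 := Aux.reg_half M N C' hM hN hNC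
  have h2 := Aux.reg_comap Prod.swap _ (Aux.reg_half _ _ C' (Aux.reg_swap M hM) (Aux.reg_swap N hN)
    (by
      intro q hq
      have := hNC _ hq
      simp only [Prod.fst_swap, Prod.snd_swap] at this
      omega))
  refine Aux.reg_congr (Aux.reg_or h1 h2) (fun w => ?_)
  change _ ↔ ((∃ q ∈ M, ∃ r ∈ N, r.2.length ≤ r.1.length ∧ w = padL (q.1 ++ r.1) (q.2 ++ r.2)) ∨
    (∃ q : List α × List α, q.swap ∈ M ∧ ∃ r : List α × List α, r.swap ∈ N ∧ r.2.length ≤ r.1.length ∧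
      w.map Prod.swap = padL (q.1 ++ r.1) (q.2 ++ r.2)))
  constructor
  · rintro ⟨q, hq, r, hr, rfl⟩
    rcases le_total r.2.length r.1.length with hl | hl
    · exact Or.inl ⟨q, hq, r, hr, hl, rfl⟩
    · exact Or.inr ⟨q.swap, by simpa using hq, r.swap, by simpa using hr, hl, Aux.padL_swap _ _⟩
  · rintro (⟨q, hq, r, hr, _, rfl⟩ | ⟨q, hq, r, hr, _, h⟩)
    · exact ⟨q, hq, r, hr, rfl⟩
    · refine ⟨_, hq, _, hr, ?_⟩
      have := congrArg (List.map Prod.swap) h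
      rw [Aux.padL_swap] at this
      simpa using this
end

section
/- Let S = sgp^+⟨a_1,…,a_n | u = v⟩ with u = a_{i_1}⋯a_{i_k}, v = a_{j_1}⋯a_{j_k} words of the same length k ≥ 2 over A = {a_1,…,a_n}, u ≠ v, and suppose {u = v} is a Gröbner–Shirshov basis, equivalently that L = A^+ − A^*{u}A^* contains exactly one representative of each element of S. If S satisfies one of the following conditions, then S is biautomatic and prefix-automatic: (1) for every t ≥ 1, v(t) ≢ u[t] and v[t] ≢ u(t); (2) u consists of k pairwise distinct letters; (3) k = 2; (4) some letter occurring in u does not occur in v; (5) u is not of the form w w' w and v is not of the form s s' s for any nonempty words w, s and (possibly empty) words w', s'. -/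
/-! ### Regularity toolkit -/

section Toolkit

/-- A set of words defined through a right-to-left fold with finitely many values is regular. -/
theorem isReg_of_fold {β τ : Type} (F : List β → τ) (G : β → τ → τ)
    (hF : ∀ a p, F (a :: p) = G a (F p)) (hfin : (Set.range F).Finite) (S : Set τ) :
    IsReg {p | F p ∈ S} := by
  have : Fintype (Set.range F) := hfin.fintype
  let M : DFA β (Set.range F) :=
    { step := fun s a => ⟨G a s.1, by
        obtain ⟨p, hp⟩ := s.2
        exact ⟨a :: p, by rw [hF, hp]⟩⟩
      start := ⟨F [], [], rfl⟩
      accept := {s | s.1 ∈ S} }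
  have key : ∀ p : List β, (M.eval p.reverse).1 = F p := by
    intro p
    induction p with
    | nil => rfl
    | cons a p ih =>
      rw [List.reverse_cons, DFA.eval_append_singleton, hF, ← ih]
  have h : Language.IsRegular (M.accepts) := ⟨_, this, M, rfl⟩
  have h2 := h.reverse
  have e : ({p | F p ∈ S} : Set (List β)) = {p | p.reverse ∈ M.accepts} := by
    ext p
    change F p ∈ S ↔ p.reverse ∈ M.accepts
    rw [DFA.mem_accepts, ← key p]
    rfl
  rw [e]
  exact h2

theorem isReg_inter {β : Type} {P Q : Set (List β)} (hP : IsReg P) (hQ : IsReg Q) :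
    IsReg {p | p ∈ P ∧ p ∈ Q} :=
  Language.IsRegular.inf hP hQ

theorem isReg_rev {β : Type} {P : Set (List β)} (hP : IsReg P) :
    IsReg {p | p.reverse ∈ P} :=
  Language.IsRegular.reverse hP

/-- Inverse homomorphic images of regular languages are regular. -/
theorem isReg_comap {α β : Type} {P : Set (List α)} (hP : IsReg P) (h : β → List α) :
    IsReg {p : List β | p.flatMap h ∈ P} := by
  obtain ⟨σ, hσ, M, hM⟩ := hP
  let N : DFA β σ :=
    { step := fun s b => M.evalFrom s (h b)
      start := M.start
      accept := M.accept }
  refine ⟨σ, hσ, N, ?_⟩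
  have key : ∀ (p : List β) (s : σ), N.evalFrom s p = M.evalFrom s (p.flatMap h) := by
    intro p
    induction p with
    | nil => intro s; rfl
    | cons b p ih =>
      intro s
      rw [DFA.evalFrom_cons, ih, List.flatMap_cons, DFA.evalFrom_of_append]
  ext p
  change _ ↔ p.flatMap h ∈ P
  have : p.flatMap h ∈ P ↔ p.flatMap h ∈ M.accepts := by rw [hM]; rfl
  rw [this, DFA.mem_accepts, DFA.mem_accepts, DFA.eval, DFA.eval, key]

theorem take_finite {α : Type} [Fintype α] (k : ℕ) : {l : List α | l.length ≤ k}.Finite :=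
  List.finite_length_le α k

/-- The language of nonempty words avoiding the factor `u`. -/
def Irr {α : Type} (u : List α) : Set (List α) := {l | l ≠ [] ∧ ¬ u <:+: l}

theorem isReg_Irr {α : Type} [Fintype α] (u : List α) : IsReg (Irr u) := by
  have := isReg_of_fold (β := α) (τ := List α × Prop × Prop)
    (fun w => (w.take u.length, u <:+: w, w = []))
    (fun a s => ((a :: s.1).take u.length, (u = (a :: s.1).take u.length) ∨ s.2.1, False))
    (by
      intro a p
      have h1 : (a :: p).take u.length = (a :: p.take u.length).take u.length := by
        cases h : u.length with
        | zero => simp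
        | succ n => simp [List.take_take]
      refine Prod.ext h1 (Prod.ext ?_ ?_)
      · simp only [List.infix_cons_iff, ← h1]
        rw [List.prefix_iff_eq_take]
      · simp)
    (by
      refine Set.Finite.subset
        (((take_finite (α := α) u.length).prod (Set.finite_univ (α := Prop × Prop)))) ?_
      rintro _ ⟨w, rfl⟩
      simp)
    {s | ¬ s.2.2 ∧ ¬ s.2.1}
  exact this

end Toolkit

section Pad
variable {α : Type}

@[simp] theorem padR_cons (a d : α) (x y : List α) :
    padR (a :: x) (d :: y) = (some a, some d) :: padR x y := by
  simp [padR]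

theorem padR_nil : padR ([] : List α) [] = [] := rfl
theorem padR_one (d : α) : padR [] [d] = [(none, some d)] := rfl

theorem padL_eq_padR {x y : List α} (h : x.length = y.length) : padL x y = padR x y := by
  simp [padL, padR, h]

theorem padL_cons {x y : List α} (d : α) (h : x.length = y.length) :
    padL x (d :: y) = (none, some d) :: padR x y := by
  simp [padL, padR, h]

theorem padR_reverse (x y : List α) : (padR x y).reverse = padL x.reverse y.reverse := by
  unfold padR padL
  rw [List.zip, List.reverse_zipWith]
  · simp
  · simp; omega

theorem padL_reverse (x y : List α) : (padL x y).reverse = padR x.reverse y.reverse := by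
  have := padR_reverse x.reverse y.reverse
  rw [List.reverse_reverse, List.reverse_reverse] at this
  rw [← this, List.reverse_reverse]

/-- first projection -/
def pr1 (p : List (Option α × Option α)) : List α := p.flatMap fun q => q.1.toList
/-- second projection -/
def pr2 (p : List (Option α × Option α)) : List α := p.flatMap fun q => q.2.toList

theorem pr_padR : ∀ (x y : List α), (y.length = x.length ∨ y.length = x.length + 1) →
    pr1 (padR x y) = x ∧ pr2 (padR x y) = y
  | [], [], _ => ⟨rfl, rfl⟩
  | [], [d], _ => ⟨rfl, rfl⟩
  | [], _ :: _ :: _, h => by simp at h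
  | _ :: _, [], h => by simp at h
  | a :: x, d :: y, h => by
    have := pr_padR x y (by simpa using h)
    rw [padR_cons]
    exact ⟨congrArg (a :: ·) this.1, congrArg (d :: ·) this.2⟩

theorem pr_padL (x y : List α) (h : y.length = x.length + 1) :
    pr1 (padL x y) = x ∧ pr2 (padL x y) = y := by
  cases y with
  | nil => simp at h
  | cons d y =>
    have h' : x.length = y.length := by simpa using h.symm
    rw [padL_cons d h']
    have := pr_padR x y (Or.inl h'.symm)
    exact ⟨this.1, congrArg (d :: ·) this.2⟩

/-- well padded words on the right -/
def ShR (α : Type) : Set (List (Option α × Option α)) :=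
  {p | ∃ x y : List α, y.length = x.length + 1 ∧ p = padR x y}
/-- well padded words on the left -/
def ShL (α : Type) : Set (List (Option α × Option α)) :=
  {p | ∃ x y : List α, y.length = x.length + 1 ∧ p = padL x y}
/-- unpadded words -/
def ShE (α : Type) : Set (List (Option α × Option α)) :=
  {p | ∃ x y : List α, y.length = x.length ∧ p = padR x y}

theorem ShE_nil : [] ∈ ShE α := ⟨[], [], rfl, rfl⟩

theorem ShE_cons (r : Option α × Option α) (p : List (Option α × Option α)) :
    r :: p ∈ ShE α ↔ (∃ a d, r = (some a, some d)) ∧ p ∈ ShE α := by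
  constructor
  · rintro ⟨x, y, hl, hp⟩
    cases x with
    | nil =>
      cases y with
      | nil => simp [padR_nil] at hp
      | cons d y => simp at hl
    | cons a x =>
      cases y with
      | nil => simp at hl
      | cons d y =>
        rw [padR_cons, List.cons.injEq] at hp
        exact ⟨⟨a, d, hp.1⟩, x, y, by simpa using hl, hp.2⟩
  · rintro ⟨⟨a, d, rfl⟩, x, y, hl, rfl⟩
    exact ⟨a :: x, d :: y, by simp [hl], by simp⟩

theorem ShL_cons (r : Option α × Option α) (p : List (Option α × Option α)) :
    r :: p ∈ ShL α ↔ (∃ d, r = (none, some d)) ∧ p ∈ ShE α := by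
  constructor
  · rintro ⟨x, y, hl, hp⟩
    cases y with
    | nil => simp at hl
    | cons d y =>
      have h' : x.length = y.length := by simpa using hl.symm
      rw [padL_cons d h', List.cons.injEq] at hp
      exact ⟨⟨d, hp.1⟩, x, y, h'.symm, hp.2⟩
  · rintro ⟨⟨d, rfl⟩, x, y, hl, rfl⟩
    exact ⟨x, d :: y, by simp [hl], by rw [padL_cons d hl.symm]⟩

theorem isReg_ShL : IsReg (ShL α) := by
  have := isReg_of_fold (β := Option α × Option α) (τ := Prop × Prop)
    (fun p => (p ∈ ShE α, p ∈ ShL α))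
    (fun r s => ((∃ a d, r = (some a, some d)) ∧ s.1, (∃ d, r = (none, some d)) ∧ s.1))
    (by
      intro r p
      simp only [ShE_cons, ShL_cons])
    (Set.toFinite _) {s | s.2}
  exact this

theorem isReg_ShR : IsReg (ShR α) := by
  convert isReg_rev (isReg_ShL (α := α)) using 1
  ext p
  constructor
  · rintro ⟨x, y, hl, rfl⟩
    exact ⟨x.reverse, y.reverse, by simpa using hl, padR_reverse x y⟩
  · rintro ⟨x, y, hl, hp⟩
    refine ⟨x.reverse, y.reverse, by simpa using hl, ?_⟩
    rw [← padL_reverse, ← hp, List.reverse_reverse]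

theorem isReg_diag {L : Set (List α)} (hL : IsReg L) :
    IsReg {p | ∃ x ∈ L, p = padR x x} := by
  have h1 := isReg_of_fold (β := Option α × Option α) (τ := Prop)
    (fun p => ∃ x, p = padR x x)
    (fun r s => (∃ a, r = (some a, some a)) ∧ s)
    (by
      intro r p
      refine propext ⟨?_, ?_⟩
      · rintro ⟨x, hx⟩
        cases x with
        | nil => simp [padR_nil] at hx
        | cons a x =>
          rw [padR_cons, List.cons.injEq] at hx
          exact ⟨⟨a, hx.1⟩, x, hx.2⟩
      · rintro ⟨⟨a, rfl⟩, x, rfl⟩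
        exact ⟨a :: x, by simp⟩)
    (Set.toFinite _) {s | s}
  have h2 := isReg_comap hL (fun q : Option α × Option α => q.1.toList)
  convert isReg_inter h1 h2 using 1
  ext p
  constructor
  · rintro ⟨x, hx, rfl⟩
    refine ⟨⟨x, rfl⟩, ?_⟩
    change pr1 _ ∈ L
    rwa [(pr_padR x x (Or.inl rfl)).1]
  · rintro ⟨⟨x, rfl⟩, hx⟩
    change pr1 _ ∈ L at hx
    rw [(pr_padR x x (Or.inl rfl)).1] at hx
    exact ⟨x, hx, rfl⟩

end Pad

/-! ### The congruence -/

section Cong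
variable {α : Type}

theorem WordEq.refl' {R : Set (List α × List α)} (x : List α) : WordEq R x x :=
  Relation.EqvGen.refl x

theorem WordEq.symm' {R : Set (List α × List α)} {x y : List α} (h : WordEq R x y) :
    WordEq R y x := Relation.EqvGen.symm _ _ h

theorem WordEq.trans' {R : Set (List α × List α)} {x y z : List α} (h : WordEq R x y)
    (h' : WordEq R y z) : WordEq R x z := Relation.EqvGen.trans _ _ _ h h'

theorem WordEq.ctx {R : Set (List α × List α)} {x y : List α} (h : WordEq R x y)
    (p s : List α) : WordEq R (p ++ x ++ s) (p ++ y ++ s) := by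
  induction h with
  | rel x y h =>
    obtain ⟨p', u, v, s', hR, rfl, rfl⟩ := h
    exact Relation.EqvGen.rel _ _ ⟨p ++ p', u, v, s' ++ s, hR, by simp, by simp⟩
  | refl x => exact WordEq.refl' _
  | symm x y _ ih => exact ih.symm'
  | trans x y z _ _ ih1 ih2 => exact ih1.trans' ih2

theorem WordEq.left {R : Set (List α × List α)} {x y : List α} (h : WordEq R x y)
    (p : List α) : WordEq R (p ++ x) (p ++ y) := by
  simpa using h.ctx p []

theorem WordEq.right {R : Set (List α × List α)} {x y : List α} (h : WordEq R x y)
    (s : List α) : WordEq R (x ++ s) (y ++ s) := by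
  simpa using h.ctx [] s

theorem WordEq.len {u v : List α} (huv : u.length = v.length) {x y : List α}
    (h : WordEq {(u, v)} x y) : x.length = y.length := by
  induction h with
  | rel x y h =>
    obtain ⟨p', u', v', s', hR, rfl, rfl⟩ := h
    simp only [Set.mem_singleton_iff, Prod.mk.injEq] at hR
    obtain ⟨rfl, rfl⟩ := hR
    simp [huv]
  | refl x => rfl
  | symm x y _ ih => exact ih.symm
  | trans x y z _ _ ih1 ih2 => exact ih1.trans ih2

theorem WordEq.rev {u v : List α} {x y : List α}
    (h : WordEq {(u, v)} x y) : WordEq {(u.reverse, v.reverse)} x.reverse y.reverse := by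
  induction h with
  | rel x y h =>
    obtain ⟨p', u', v', s', hR, rfl, rfl⟩ := h
    simp only [Set.mem_singleton_iff, Prod.mk.injEq] at hR
    obtain ⟨rfl, rfl⟩ := hR
    exact Relation.EqvGen.rel _ _ ⟨s'.reverse, u'.reverse, v'.reverse, p'.reverse, by simp,
      by simp, by simp⟩
  | refl x => exact WordEq.refl' _
  | symm x y _ ih => exact ih.symm'
  | trans x y z _ _ ih1 ih2 => exact ih1.trans' ih2

theorem WordEq.basic (u v s : List α) : WordEq {(u, v)} (u ++ s) (v ++ s) :=
  Relation.EqvGen.rel _ _ ⟨[], u, v, s, rfl, by simp, by simp⟩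

/-! ### The carry automaton -/

/-- Right-to-left carry automaton computing right multiplication by `b`. -/
def Reach (R : Set (List α × List α)) (K : ℕ) (b : α) :
    List (Option α × Option α) → List α → List α → Prop
  | [], c, e => c = [b] ∧ e = []
  | (r :: p), c', e' => c'.length ≤ K ∧ e'.length ≤ K ∧
      ∃ c e f, Reach R K b p c e ∧ WordEq R (r.1.toList ++ c) (c' ++ f) ∧
        r.2.toList ++ e = e' ++ f

theorem Reach.sound {R : Set (List α × List α)} {K : ℕ} {b : α} :
    ∀ {p : List (Option α × Option α)} {c e : List α}, Reach R K b p c e →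
      ∃ s, WordEq R (pr1 p ++ [b]) (c ++ s) ∧ pr2 p = e ++ s
  | [], c, e, h => by
    obtain ⟨rfl, rfl⟩ := h
    exact ⟨[], WordEq.refl' _, rfl⟩
  | (r :: p), c', e', h => by
    obtain ⟨-, -, c, e, f, hr, h1, h2⟩ := h
    obtain ⟨s, hs1, hs2⟩ := Reach.sound hr
    refine ⟨f ++ s, ?_, ?_⟩
    · have a1 := hs1.left r.1.toList
      have a2 := h1.right s
      have : pr1 (r :: p) = r.1.toList ++ pr1 p := rfl
      rw [this, List.append_assoc]
      refine a1.trans' ?_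
      simpa using a2
    · have : pr2 (r :: p) = r.2.toList ++ pr2 p := rfl
      rw [this, hs2, ← List.append_assoc, h2, List.append_assoc]

theorem isReg_Reach [Fintype α] (R : Set (List α × List α)) (K : ℕ) (hK : 1 ≤ K) (b : α) :
    IsReg {p | ∃ c, Reach R K b p c c} := by
  have := isReg_of_fold (β := Option α × Option α) (τ := Set (List α × List α))
    (fun p => {q | Reach R K b p q.1 q.2})
    (fun r s => {q | q.1.length ≤ K ∧ q.2.length ≤ K ∧ ∃ c e f, (c, e) ∈ s ∧
      WordEq R (r.1.toList ++ c) (q.1 ++ f) ∧ r.2.toList ++ e = q.2 ++ f})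
    (by intro r p; rfl)
    (by
      refine Set.Finite.subset
        ((take_finite (α := α) K).prod (take_finite (α := α) K)).finite_subsets ?_
      rintro _ ⟨p, rfl⟩ ⟨c, e⟩ hq
      change Reach R K b p c e at hq
      cases p with
      | nil =>
        obtain ⟨rfl, rfl⟩ := hq
        simp [hK]
      | cons r p => exact ⟨hq.1, hq.2.1⟩)
    {s | ∃ c, (c, c) ∈ s}
  exact this

/-- The sequence of bounded carries of a computation. -/
inductive Chain (R : Set (List α × List α)) (K : ℕ) (b : α) :
    List α → List α → List α → Prop
  | nil : Chain R K b [] [b] []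
  | cons (a : α) (x c s c' f : List α) : Chain R K b x c s → 1 ≤ c'.length → c'.length ≤ K →
      c'.length + f.length = c.length + 1 → WordEq R (a :: c) (c' ++ f) →
      Chain R K b (a :: x) c' (f ++ s)

theorem Chain.lens {R : Set (List α × List α)} {K : ℕ} {b : α} {x c s : List α} (hK : 1 ≤ K)
    (h : Chain R K b x c s) :
    1 ≤ c.length ∧ c.length ≤ K ∧ c.length + s.length = x.length + 1 := by
  induction h with
  | nil => simp [hK]
  | cons a x c s c' f _ h1 h2 h3 _ ih => simp; omega

theorem Chain.sound {R : Set (List α × List α)} {K : ℕ} {b : α} {x c s : List α}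
    (h : Chain R K b x c s) : WordEq R (x ++ [b]) (c ++ s) := by
  induction h with
  | nil => exact WordEq.refl' _
  | cons a x c s c' f _ h1 h2 h3 h4 ih =>
    have a1 := ih.left [a]
    have a2 := h4.right s
    simp only [List.append_assoc, List.cons_append] at a1 a2 ⊢
    exact a1.trans' a2

theorem Chain.reach {R : Set (List α × List α)} {K : ℕ} {b : α} {x c s : List α} (hK : 1 ≤ K)
    (h : Chain R K b x c s) : ∀ e : List α, ((e ++ s).length = x.length ∨
      (e ++ s).length = x.length + 1) → Reach R K b (padR x (e ++ s)) c e := by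
  induction h with
  | nil =>
    intro e he
    match e, he with
    | [], _ => exact ⟨rfl, rfl⟩
    | [d], _ => exact ⟨hK, hK, [b], [], [], ⟨rfl, rfl⟩, WordEq.refl' _, rfl⟩
    | _ :: _ :: _, he => simp at he
  | cons a x c s c' f hc h1 h2 h3 h4 ih =>
    intro e' he
    have hl := hc.lens hK
    cases hef : e' ++ f with
    | nil =>
      have : e'.length + f.length = 0 := by rw [← List.length_append, hef]; rfl
      simp at he
      omega
    | cons d e =>
      have hel : e'.length + f.length = e.length + 1 := by rw [← List.length_append, hef]; rfl
      have h5 : e' ++ (f ++ s) = d :: (e ++ s) := by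
        rw [← List.append_assoc, hef]; rfl
      rw [h5] at he ⊢
      rw [padR_cons]
      have he' : (e ++ s).length = x.length ∨ (e ++ s).length = x.length + 1 := by
        simp at he ⊢; omega
      refine ⟨h2, ?_, c, e, f, ih e he', h4, ?_⟩
      · simp at he'; omega
      · rw [hef]; rfl

/-! ### The combinatorial condition -/

/-- Abstract condition under which reductions only cascade to the left. -/
def Good (u v : List α) : Prop :=
  ∃ Q : List α → Prop, Q [] ∧ ∀ p t r n, p ≠ [] → t ≠ [] → u = p ++ t → v = t ++ r → Q n →
    ¬ u <:+: v ++ n → Q (r ++ n) ∧ ¬ u <:+: v ++ (r ++ n)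

theorem exists_chain {u v : List α} (hlen : u.length = v.length) (hu : 1 ≤ u.length)
    (huv : u ≠ v) (hG : Good u v) (b : α) (hb : ¬ u <:+: [b]) (x : List α) (hx : ¬ u <:+: x) :
    ∃ c s, Chain {(u, v)} u.length b x c s ∧ ¬ u <:+: c ++ s := by
  obtain ⟨Q, hQ0, hQ⟩ := hG
  have hstep : ∀ (a : α) (x N N' : List α),
      Chain {(u, v)} u.length b x (N.take u.length) (N.drop u.length) →
      (N' = a :: N ∨ ∃ n, a :: N = u ++ n ∧ N' = v ++ n) →
      Chain {(u, v)} u.length b (a :: x) (N'.take u.length) (N'.drop u.length) := by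
    intro a x N N' hc hN
    have hNl : 1 ≤ N.length := by
      have := hc.lens hu
      simp at this
      omega
    rcases hN with rfl | ⟨n, h1, rfl⟩
    · have e1 : (a :: N).drop u.length =
          (a :: N.take u.length).drop u.length ++ N.drop u.length := by
        obtain ⟨k, hk⟩ : ∃ k, u.length = k + 1 := ⟨u.length - 1, by omega⟩
        rw [hk]
        simp only [List.drop_succ_cons]
        conv_lhs => rw [← List.take_append_drop (k+1) N, List.drop_append]
        congr 1
        by_cases h : k + 1 ≤ N.length
        · simp [h]
        · rw [List.drop_eq_nil_of_le (by omega : N.length ≤ k + 1)]; simp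
      have e2 : (a :: N).take u.length = (a :: N.take u.length).take u.length := by
        obtain ⟨k, hk⟩ : ∃ k, u.length = k + 1 := ⟨u.length - 1, by omega⟩
        rw [hk]
        simp [List.take_take]
      rw [e1, e2]
      refine Chain.cons a x _ _ _ _ hc ?_ ?_ ?_ ?_
      · simp; omega
      · simp
      · rw [← List.length_append, List.take_append_drop]; simp
      · rw [List.take_append_drop]; exact WordEq.refl' _
    · have e1 : (v ++ n).take u.length = v := by rw [hlen]; simp
      have e2 : (v ++ n).drop u.length = n := by rw [hlen]; simp
      have e3 : a :: N.take u.length = u ++ n.take 1 := by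
        have : a :: N.take u.length = (a :: N).take (u.length + 1) := by simp
        rw [this, h1, List.take_append]
        simp
      have e4 : N.drop u.length = n.drop 1 := by
        have : N.drop u.length = (a :: N).drop (u.length + 1) := by simp
        rw [this, h1, List.drop_append]
        simp
      rw [e1, e2]
      have := Chain.cons a x _ _ v (n.take 1) hc (by omega) (by omega)
        (by
          have := congrArg List.length e3
          simp only [List.length_cons, List.length_append] at this ⊢
          omega)
        (by rw [e3]; exact WordEq.basic _ _ _)
      rwa [e4, List.take_append_drop] at this
  suffices h : ∃ N, Chain {(u, v)} u.length b x (N.take u.length) (N.drop u.length) ∧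
      ¬ u <:+: N ∧ (N = x ++ [b] ∨ ∃ w x' n, x = w ++ x' ∧ N = w ++ v ++ n ∧ Q n) by
    obtain ⟨N, h1, h2, -⟩ := h
    exact ⟨_, _, h1, by rwa [List.take_append_drop]⟩
  induction x with
  | nil =>
    refine ⟨[b], ?_, hb, Or.inl rfl⟩
    obtain ⟨k, hk⟩ : ∃ k, u.length = k + 1 := ⟨u.length - 1, by omega⟩
    rw [hk]
    simpa using Chain.nil
  | cons a x ih =>
    have hx' : ¬ u <:+: x := fun h => hx (h.trans (List.suffix_cons a x).isInfix)
    obtain ⟨N, hc, hN, hI⟩ := ih hx'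
    by_cases hred : u <:+: a :: N
    · rw [List.infix_cons_iff] at hred
      obtain ⟨n, hn⟩ := hred.resolve_right hN
      refine ⟨v ++ n, hstep a x N _ hc (Or.inr ⟨n, hn.symm, rfl⟩), ?_⟩
      rcases hI with rfl | ⟨w, x', n0, rfl, rfl, hQn⟩
      · have hn0 : n = [] := by
          by_contra hne
          apply hx
          obtain ⟨n', d, rfl⟩ := List.eq_nil_or_concat n |>.resolve_left hne
          have h2 : u ++ n' = a :: x := by
            rw [List.concat_eq_append, ← List.append_assoc, ← List.cons_append] at hn
            exact (List.append_inj' hn rfl).1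
          exact ⟨[], n', by simpa using h2⟩
        subst hn0
        have : ¬ u <:+: v ++ [] := by
          intro h
          rw [List.append_nil] at h
          exact huv (h.eq_of_length hlen)
        exact ⟨this, Or.inr ⟨[], a :: x, [], rfl, rfl, hQ0⟩⟩
      · have hn' : (a :: w) ++ (v ++ n0) = u ++ n := by rw [hn]; simp
        rcases List.append_eq_append_iff.1 hn' with ⟨t, h1, h2⟩ | ⟨t, h1, h2⟩
        · by_cases ht : t = []
          · exfalso
            apply hx
            subst ht
            exact ⟨[], x', by rw [h1]; simp⟩
          · have hlt : t.length ≤ v.length := by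
              rw [← hlen, h1]; simp; omega
            rcases List.append_eq_append_iff.1 h2 with ⟨r, h3, h4⟩ | ⟨r, h3, h4⟩
            · have : r = [] := by
                have := congrArg List.length h3
                simp at this
                exact List.eq_nil_of_length_eq_zero (by omega)
              subst this
              exfalso
              have := congrArg List.length h3
              have h5 := congrArg List.length h1
              simp at this h5
              omega
            · have hvn : ¬ u <:+: v ++ n0 := fun h => hN (by
                refine h.trans ⟨w, [], by simp⟩)
              have := hQ (a :: w) t r n0 (by simp) ht h1 h3 hQn hvn
              rw [h4]
              exact ⟨this.2, Or.inr ⟨[], a :: (w ++ x'), r ++ n0, rfl, by simp, this.1⟩⟩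
        · exfalso
          apply hx
          refine ⟨[], t ++ x', ?_⟩
          rw [← List.cons_append, h1]
          simp
    · refine ⟨a :: N, hstep a x N _ hc (Or.inl rfl), hred, ?_⟩
      rcases hI with rfl | ⟨w, x', n0, rfl, rfl, hQn⟩
      · exact Or.inl rfl
      · exact Or.inr ⟨a :: w, x', n0, rfl, rfl, hQn⟩

/-- Right multiplication is regular, for both paddings. -/
theorem main_right [Fintype α] {u v : List α} (hlen : u.length = v.length) (hu : 2 ≤ u.length)
    (huv : u ≠ v) (hG : Good u v)
    (hU : ∀ x ∈ Irr u, ∀ y ∈ Irr u, WordEq {(u, v)} x y → x = y) (b : α) :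
    IsReg {p | ∃ x ∈ Irr u, ∃ y ∈ Irr u, WordEq {(u, v)} (x ++ [b]) y ∧ p = padR x y} ∧
    IsReg {p | ∃ x ∈ Irr u, ∃ y ∈ Irr u, WordEq {(u, v)} (x ++ [b]) y ∧ p = padL x y} := by
  have hb : ¬ u <:+: [b] := by
    intro h
    have := h.length_le
    simp at this
    omega
  have hch : ∀ x ∈ Irr u, ∀ y ∈ Irr u, WordEq {(u, v)} (x ++ [b]) y →
      ∃ c s, Chain {(u, v)} u.length b x c s ∧ y = c ++ s := by
    intro x hx y hy hxy
    obtain ⟨c, s, h1, h2⟩ := exists_chain hlen (by omega) huv hG b hb x hx.2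
    refine ⟨c, s, h1, hU _ hy _ ⟨?_, h2⟩ (hxy.symm'.trans' h1.sound)⟩
    intro h
    have := (h1.lens (by omega)).1
    have h3 := congrArg List.length h
    simp at h3
    simp [h3.1] at this
  have r1 := isReg_comap (isReg_Irr u) (fun q : Option α × Option α => q.1.toList)
  have r2 := isReg_comap (isReg_Irr u) (fun q : Option α × Option α => q.2.toList)
  have r3 := isReg_Reach {(u, v)} u.length (by omega) b
  have r4 := isReg_inter (isReg_inter r1 r2) r3
  have hl : ∀ {x y : List α}, WordEq {(u, v)} (x ++ [b]) y → y.length = x.length + 1 := by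
    intro x y h
    have := h.len hlen
    simpa using this.symm
  constructor
  · convert isReg_inter isReg_ShR r4 using 1
    ext p
    constructor
    · rintro ⟨x, hx, y, hy, hxy, rfl⟩
      obtain ⟨e1, e2⟩ := pr_padR x y (Or.inr (hl hxy))
      refine ⟨⟨x, y, hl hxy, rfl⟩, ⟨?_, ?_⟩, ?_⟩
      · change pr1 _ ∈ Irr u; rwa [e1]
      · change pr2 _ ∈ Irr u; rwa [e2]
      · obtain ⟨c, s, h1, rfl⟩ := hch x hx y hy hxy
        exact ⟨c, h1.reach (by omega) c (Or.inr (hl hxy))⟩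
    · rintro ⟨⟨x, y, hxy, rfl⟩, ⟨h1, h2⟩, c, h3⟩
      obtain ⟨e1, e2⟩ := pr_padR x y (Or.inr hxy)
      change pr1 _ ∈ Irr u at h1
      change pr2 _ ∈ Irr u at h2
      obtain ⟨s, hs1, hs2⟩ := h3.sound
      rw [e1] at h1 hs1
      rw [e2] at h2 hs2
      exact ⟨x, h1, y, h2, hs2 ▸ hs1, rfl⟩
  · convert isReg_inter isReg_ShL r4 using 1
    ext p
    constructor
    · rintro ⟨x, hx, y, hy, hxy, rfl⟩
      obtain ⟨e1, e2⟩ := pr_padL x y (hl hxy)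
      refine ⟨⟨x, y, hl hxy, rfl⟩, ⟨?_, ?_⟩, ?_⟩
      · change pr1 _ ∈ Irr u; rwa [e1]
      · change pr2 _ ∈ Irr u; rwa [e2]
      · obtain ⟨c, s, h1, rfl⟩ := hch x hx y hy hxy
        have h2 := h1.lens (by omega)
        cases c with
        | nil => simp at h2
        | cons d e =>
          have h3 : (e ++ s).length = x.length := by simpa using hl hxy
          rw [List.cons_append, padL_cons d h3.symm]
          exact ⟨d :: e, h2.2.1, h2.2.1, d :: e, e, [], h1.reach (by omega) e (Or.inl h3),
            by simpa using WordEq.refl' _, by simp⟩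
    · rintro ⟨⟨x, y, hxy, rfl⟩, ⟨h1, h2⟩, c, h3⟩
      obtain ⟨e1, e2⟩ := pr_padL x y hxy
      change pr1 _ ∈ Irr u at h1
      change pr2 _ ∈ Irr u at h2
      obtain ⟨s, hs1, hs2⟩ := h3.sound
      rw [e1] at h1 hs1
      rw [e2] at h2 hs2
      exact ⟨x, h1, y, h2, hs2 ▸ hs1, rfl⟩

end Cong

/-! ### The five conditions -/

section Conditions
variable {α : Type}

theorem no_border : ∀ (N : ℕ) (u x m y : List α), m.length ≤ N →
    (∀ w w' : List α, w ≠ [] → u ≠ w ++ w' ++ w) → x ≠ [] → m ≠ [] → u = x ++ m → u = m ++ y →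
    False := by
  intro N
  induction N with
  | zero =>
    intro u x m y hN _ _ hm _ _
    exact hm (List.eq_nil_of_length_eq_zero (by omega))
  | succ N ih =>
    intro u x m y hN hu hx hm h1 h2
    rcases List.append_eq_append_iff.1 (h1.symm.trans h2) with ⟨m', h3, h4⟩ | ⟨w', h3, h4⟩
    · by_cases hm' : m' = []
      · subst hm'
        simp at h3 h4
        exact hu m [] hm (by rw [h1, h3]; simp)
      · have hxl : 1 ≤ x.length := List.length_pos_of_ne_nil hx
        refine ih u (x ++ x) m' (y ++ y) ?_ hu (by simp [hx]) hm' ?_ ?_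
        · have := congrArg List.length h3
          simp at this
          omega
        · rw [List.append_assoc, ← h3, h1]
        · rw [← List.append_assoc, ← h4, h2]
    · exact hu m w' hm (by rw [h1, h3])

theorem good_cond1 {u v : List α}
    (h : ∀ t : ℕ, 1 ≤ t → v.take t ≠ u.drop (u.length - t)) : Good u v := by
  refine ⟨fun _ => True, trivial, ?_⟩
  intro p t r n hp ht hu hv _ _
  exfalso
  apply h t.length (List.length_pos_of_ne_nil ht)
  rw [hv, hu]
  simp

theorem good_cond4 {u v : List α} (x : α) (hx : x ∈ u) (hxv : x ∉ v) : Good u v := by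
  refine ⟨fun n => x ∉ n, by simp, ?_⟩
  intro p t r n hp ht hu hv hn _
  have hr : x ∉ r := fun h => hxv (by rw [hv]; simp [h])
  refine ⟨by simp [hr, hn], fun h => ?_⟩
  have := h.subset hx
  simp [hr, hn, hxv] at this

theorem good_cond2 {u v : List α} (hlen : u.length = v.length) (huv : u ≠ v)
    (hnd : u.Nodup) : Good u v := by
  classical
  by_cases h4 : ∃ x ∈ u, x ∉ v
  · obtain ⟨x, h1, h2⟩ := h4
    exact good_cond4 x h1 h2
  have hsub : u ⊆ v := by
    intro x hx
    by_contra h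
    exact h4 ⟨x, hx, h⟩
  have hperm : u.Perm v := (hnd.subperm hsub).perm_of_length_le hlen.ge
  have hvnd : v.Nodup := hperm.nodup hnd
  rcases List.eq_nil_or_concat u with rfl | ⟨u0, c, hu0⟩
  · exact absurd (List.eq_nil_of_length_eq_zero hlen.symm).symm huv
  rw [List.concat_eq_append] at hu0
  refine ⟨fun n => c ∉ n, by simp, ?_⟩
  intro p t r n hp ht hu hv hn _
  obtain ⟨t0, c', rfl⟩ := (List.eq_nil_or_concat t).resolve_left ht
  rw [List.concat_eq_append] at hu hv
  have hc : c = c' := by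
    rw [hu0, ← List.append_assoc] at hu
    have := (List.append_inj' hu rfl).2
    simpa using this
  subst hc
  have hvnd' := hvnd
  rw [hv] at hvnd'
  have hcr : c ∉ r := by
    intro h
    simp [List.nodup_append] at hvnd'
    grind
  have hct : c ∉ t0 := by
    intro h
    simp [List.nodup_append] at hvnd'
    grind
  refine ⟨by simp [hcr, hn], ?_⟩
  rintro ⟨A, B, hAB⟩
  rw [hu0, hv] at hAB
  have e : (A ++ u0) ++ (c :: B) = t0 ++ (c :: (r ++ (r ++ n))) := by simpa using hAB
  have hl1 : u.length = u0.length + 1 := by rw [hu0]; simp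
  have hl2 : v.length = t0.length + 1 + r.length := by rw [hv]; simp; omega
  rcases List.append_eq_append_iff.1 e with ⟨q, h1, h2⟩ | ⟨q, h1, h2⟩
  · cases q with
    | nil =>
      have hl3 := congrArg List.length h1
      simp at hl3
      have hA : A = [] := List.eq_nil_of_length_eq_zero (by omega)
      have hr : r = [] := List.eq_nil_of_length_eq_zero (by omega)
      subst hA hr
      simp at h1
      apply huv
      rw [hu0, hv, h1]
      simp
    | cons d q =>
      have : d = c := by simp at h2; exact h2.1.symm
      apply hct
      rw [h1, this]
      simp
  · cases q with
    | nil =>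
      have hl3 := congrArg List.length h1
      simp at hl3
      have hA : A = [] := List.eq_nil_of_length_eq_zero (by omega)
      have hr : r = [] := List.eq_nil_of_length_eq_zero (by omega)
      subst hA hr
      simp at h1
      apply huv
      rw [hu0, hv, h1]
      simp
    | cons d q =>
      simp at h2
      have : c ∈ r ++ (r ++ n) := by rw [h2.2]; simp
      simp [hcr, hn] at this

theorem good_cond5 {u v : List α} (hlen : u.length = v.length) (huv : u ≠ v)
    (hu : ∀ w w' : List α, w ≠ [] → u ≠ w ++ w' ++ w)
    (hv : ∀ w w' : List α, w ≠ [] → v ≠ w ++ w' ++ w) : Good u v := by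
  refine ⟨fun _ => True, trivial, ?_⟩
  intro p t r n hp ht hpt htr _ hirr
  refine ⟨trivial, ?_⟩
  rintro ⟨A, B, hAB⟩
  rw [List.append_assoc] at hAB
  rcases List.append_eq_append_iff.1 hAB with ⟨s, h1, h2⟩ | ⟨s, h1, h2⟩
  swap
  · -- the occurrence starts after `v`
    apply hirr
    have : u <:+: r ++ n := ⟨s, B, by rw [h2]; simp⟩
    refine this.trans ⟨t, [], by rw [htr]; simp⟩
  have hlA := congrArg List.length h1
  simp only [List.length_append] at hlA
  have hlp : 1 ≤ p.length := List.length_pos_of_ne_nil hp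
  have hlt : 1 ≤ t.length := List.length_pos_of_ne_nil ht
  have hlu := congrArg List.length hpt
  have hlv := congrArg List.length htr
  simp only [List.length_append] at hlu hlv
  by_cases hs : s = []
  · subst hs
    apply hirr
    have : u <:+: r ++ n := ⟨[], B, by simpa using h2⟩
    refine this.trans ⟨t, [], by rw [htr]; simp⟩
  have hls : 1 ≤ s.length := List.length_pos_of_ne_nil hs
  by_cases hA : A = []
  · subst hA
    rw [List.nil_append] at h1
    rw [h1] at hlen
    rw [← h1] at h2 hlen
    exact huv (List.append_inj h2 hlen).1
  have hlA1 : 1 ≤ A.length := List.length_pos_of_ne_nil hA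
  -- `u = s ++ q`
  rcases List.append_eq_append_iff.1 h2 with ⟨q, h3, h4⟩ | ⟨q, h3, h4⟩
  · have := congrArg List.length h3
    simp only [List.length_append] at this
    omega
  have hlq := congrArg List.length h3
  simp only [List.length_append] at hlq
  rcases List.append_eq_append_iff.1 (h1.symm.trans htr) with ⟨m, h5, h6⟩ | ⟨m, h5, h6⟩
  · by_cases hm : m = []
    · subst hm
      simp only [List.append_nil, List.nil_append] at h5 h6
      subst h5 h6
      rcases List.append_eq_append_iff.1 h4 with ⟨z, h7, h8⟩ | ⟨z, h7, h8⟩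
      · have hq : q = t := by
          have := hpt.symm.trans h3
          exact (List.append_inj' this (by omega)).2.symm
        subst hq
        exact hv s z hs (by rw [h1, h7])
      · have hq : q = t := by
          have := hpt.symm.trans h3
          exact (List.append_inj' this (by omega)).2.symm
        subst hq
        exact no_border _ u p q (z ++ q) le_rfl hu hp ht hpt (by rw [h3, h7]; simp)
    · refine no_border _ u (p ++ A) m (r ++ q) le_rfl hu (by simp [hp]) hm ?_ ?_
      · rw [hpt, h5]; simp
      · rw [h3, h6]; simp
  · -- `A = t ++ m`, `r = m ++ s`
    have hl5 := congrArg List.length h5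
    have hl6 := congrArg List.length h6
    simp only [List.length_append] at hl5 hl6
    rw [h6, List.append_assoc] at h4
    rcases List.append_eq_append_iff.1 h4 with ⟨z, h7, h8⟩ | ⟨z, h7, h8⟩
    swap
    · have := congrArg List.length h7
      simp only [List.length_append] at this
      omega
    have hl7 := congrArg List.length h7
    simp only [List.length_append] at hl7
    have hzt : z = t := by
      have : p ++ t = (s ++ m) ++ z := by rw [← hpt, h3, h7]; simp
      exact (List.append_inj' this (by omega)).2.symm
    subst hzt
    rcases List.append_eq_append_iff.1 h8 with ⟨y, h9, h10⟩ | ⟨y, h9, h10⟩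
    · exact hv s (y ++ m) hs (by rw [htr, h6, h9]; simp)
    · exact no_border _ u p z (y ++ q) le_rfl hu hp ht hpt (by rw [h3, h9]; simp)

theorem good_cond3 {u v : List α} (hk : u.length = 2) (hlen : u.length = v.length) (huv : u ≠ v)
    (hU : ∀ x ∈ Irr u, ∀ y ∈ Irr u, WordEq {(u, v)} x y → x = y) : Good u v := by
  classical
  by_cases hnd : u.Nodup
  · exact good_cond2 hlen huv hnd
  by_cases h4 : ∃ x ∈ u, x ∉ v
  · obtain ⟨x, h1, h2⟩ := h4
    exact good_cond4 x h1 h2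
  exfalso
  obtain ⟨a, b, rfl⟩ := List.length_eq_two.1 hk
  obtain ⟨c, d, rfl⟩ := List.length_eq_two.1 (hlen.symm.trans hk)
  have hab : a = b := by
    by_contra h
    exact hnd (by simp [h])
  subst hab
  have hmem : a ∈ [c, d] := by
    by_contra h
    exact h4 ⟨a, by simp, h⟩
  have e1 : WordEq {([a, a], [c, d])} [a, a, a] [c, d, a] := WordEq.basic [a, a] [c, d] [a]
  have e2 : WordEq {([a, a], [c, d])} [a, a, a] [a, c, d] := by
    have := (WordEq.basic [a, a] [c, d] []).left [a]
    simpa using this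
  by_cases hca : c = a
  · subst hca
    have hd : d ≠ c := fun h => huv (by rw [h])
    have e3 : WordEq {([c, c], [c, d])} [c, c, d] [c, d, d] := WordEq.basic [c, c] [c, d] [d]
    have := hU [c, d, c] ⟨by simp, by simp [List.infix_cons_iff, hd.symm]⟩
      [c, d, d] ⟨by simp, by simp [List.infix_cons_iff, hd.symm]⟩
      (e1.symm'.trans' (e2.trans' e3))
    simp at this
    exact hd this.symm
  · have had : a = d := by
      simp at hmem
      exact hmem.resolve_left (fun h => hca h.symm)
    subst had
    have hac : a ≠ c := fun h => hca h.symm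
    have e3 : WordEq {([a, a], [c, a])} [c, a, a] [c, c, a] := by
      have := (WordEq.basic [a, a] [c, a] []).left [c]
      simpa using this
    have := hU [c, c, a] ⟨by simp, by simp [List.infix_cons_iff, hac]⟩
      [a, c, a] ⟨by simp, by simp [List.infix_cons_iff, hac]⟩
      (e3.symm'.trans' (e1.symm'.trans' e2))
    simp at this
    exact hca this

/-- The disjunction of the five conditions. -/
def Cond (u v : List α) : Prop :=
  (∀ t : ℕ, 1 ≤ t → v.take t ≠ u.drop (u.length - t) ∧
    v.drop (v.length - t) ≠ u.take t) ∨
  u.Nodup ∨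
  u.length = 2 ∨
  (∃ x ∈ u, x ∉ v) ∨
  ((∀ w w' : List α, w ≠ [] → u ≠ w ++ w' ++ w) ∧
    (∀ s s' : List α, s ≠ [] → v ≠ s ++ s' ++ s))

theorem good_of_cond {u v : List α} (hlen : u.length = v.length) (huv : u ≠ v)
    (hU : ∀ x ∈ Irr u, ∀ y ∈ Irr u, WordEq {(u, v)} x y → x = y) (h : Cond u v) : Good u v := by
  rcases h with h | h | h | ⟨x, h1, h2⟩ | ⟨h1, h2⟩
  · exact good_cond1 fun t ht => (h t ht).1
  · exact good_cond2 hlen huv h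
  · exact good_cond3 h hlen huv hU
  · exact good_cond4 x h1 h2
  · exact good_cond5 hlen huv h1 h2

theorem unb_rev {u : List α} (hu : ∀ w w' : List α, w ≠ [] → u ≠ w ++ w' ++ w) :
    ∀ w w' : List α, w ≠ [] → u.reverse ≠ w ++ w' ++ w := by
  intro w w' hw h
  apply hu w.reverse w'.reverse (by simpa using hw)
  have := congrArg List.reverse h
  simpa using this

theorem cond_rev {u v : List α} (h : Cond u v) : Cond u.reverse v.reverse := by
  rcases h with h | h | h | ⟨x, h1, h2⟩ | ⟨h1, h2⟩
  · refine Or.inl fun t ht => ⟨fun e => (h t ht).2 ?_, fun e => (h t ht).1 ?_⟩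
    · rw [List.take_reverse, ← List.take_reverse, List.length_reverse] at e
      have := congrArg List.reverse e
      rw [List.reverse_take, List.reverse_drop] at this
      simp only [List.reverse_reverse, List.length_reverse] at this
      by_cases hl : t ≤ u.length
      · rwa [show u.length - (u.length - t) = t by omega] at this
      · rw [show u.length - t = 0 by omega] at this
        rw [this, List.take_of_length_le (by omega), List.take_of_length_le (by omega)]
    · rw [List.length_reverse] at e
      have := congrArg List.reverse e
      rw [List.reverse_take, List.reverse_drop] at this
      simp only [List.reverse_reverse, List.length_reverse] at this
      by_cases hl : t ≤ v.length
      · rwa [show v.length - (v.length - t) = t by omega] at this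
      · rw [show v.length - t = 0 by omega] at this
        rw [← this, List.take_of_length_le (by omega), List.take_of_length_le (by omega)]
  · exact Or.inr (Or.inl (List.nodup_reverse.2 h))
  · exact Or.inr (Or.inr (Or.inl (by simpa using h)))
  · exact Or.inr (Or.inr (Or.inr (Or.inl ⟨x, by simpa using h1, by simpa using h2⟩)))
  · exact Or.inr (Or.inr (Or.inr (Or.inr ⟨unb_rev h1, unb_rev h2⟩)))

theorem Irr_rev {u x : List α} : x.reverse ∈ Irr u.reverse ↔ x ∈ Irr u := by
  simp [Irr]

theorem Irr_rev' {u x : List α} (h : x ∈ Irr u.reverse) : x.reverse ∈ Irr u := by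
  rw [← Irr_rev, List.reverse_reverse]; exact h

theorem WordEq.rev' {u v x y : List α} (h : WordEq {(u.reverse, v.reverse)} x y) :
    WordEq {(u, v)} x.reverse y.reverse := by
  simpa using h.rev

/-- Left multiplication is regular, for both paddings. -/
theorem main_left [Fintype α] {u v : List α} (hlen : u.length = v.length) (hu : 2 ≤ u.length)
    (huv : u ≠ v) (hC : Cond u v)
    (hU : ∀ x ∈ Irr u, ∀ y ∈ Irr u, WordEq {(u, v)} x y → x = y) (b : α) :
    IsReg {p | ∃ x ∈ Irr u, ∃ y ∈ Irr u, WordEq {(u, v)} ([b] ++ x) y ∧ p = padR x y} ∧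
    IsReg {p | ∃ x ∈ Irr u, ∃ y ∈ Irr u, WordEq {(u, v)} ([b] ++ x) y ∧ p = padL x y} := by
  have hlen' : u.reverse.length = v.reverse.length := by simpa using hlen
  have huv' : u.reverse ≠ v.reverse := by simpa using huv
  have hU' : ∀ x ∈ Irr u.reverse, ∀ y ∈ Irr u.reverse,
      WordEq {(u.reverse, v.reverse)} x y → x = y := by
    intro x hx y hy h
    have := hU _ (Irr_rev' hx) _ (Irr_rev' hy) h.rev'
    simpa using this
  obtain ⟨h1, h2⟩ := main_right hlen' (by simpa using hu) huv'
    (good_of_cond hlen' huv' hU' (cond_rev hC)) hU' b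
  constructor
  · convert isReg_rev h2 using 1
    ext p
    constructor
    · rintro ⟨x, hx, y, hy, hxy, rfl⟩
      exact ⟨x.reverse, Irr_rev.2 hx, y.reverse, Irr_rev.2 hy, by simpa using hxy.rev,
        padR_reverse x y⟩
    · rintro ⟨x, hx, y, hy, hxy, hp⟩
      refine ⟨x.reverse, Irr_rev' hx, y.reverse, Irr_rev' hy, by simpa using hxy.rev', ?_⟩
      rw [← padL_reverse, ← hp, List.reverse_reverse]
  · convert isReg_rev h1 using 1
    ext p
    constructor
    · rintro ⟨x, hx, y, hy, hxy, rfl⟩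
      exact ⟨x.reverse, Irr_rev.2 hx, y.reverse, Irr_rev.2 hy, by simpa using hxy.rev,
        padL_reverse x y⟩
    · rintro ⟨x, hx, y, hy, hxy, hp⟩
      refine ⟨x.reverse, Irr_rev' hx, y.reverse, Irr_rev' hy, by simpa using hxy.rev', ?_⟩
      rw [← padR_reverse, ← hp, List.reverse_reverse]

theorem expandW_single (x : List α) : expandW (fun a : α => [a]) x = x := by
  induction x with
  | nil => rfl
  | cons a x ih => simpa [expandW] using ih

end Conditions

/-- let `S = sgp⁺⟨α ∣ u = v⟩` with `|u| = |v| = k ≥ 2`, `u ≠ v`,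
and `{u = v}` a Gröbner–Shirshov basis.  If one of the conditions (1)–(5)
holds, then `S` is biautomatic and prefix-automatic. -/
theorem statement_4 {α : Type} [Fintype α] (k : ℕ) (hk : 2 ≤ k)
    (u v : List α) (hu : u.length = k) (hv : v.length = k) (huv : u ≠ v)
    (R : Set (List α × List α)) (hRdef : R = {(u, v)})
    (hGSB : ∀ w : List α, w ≠ [] →
      ∃! l : List α, (l ≠ [] ∧ ¬ u <:+: l) ∧ WordEq R l w)
    (hcond :
      (∀ t : ℕ, 1 ≤ t → v.take t ≠ u.drop (u.length - t) ∧
        v.drop (v.length - t) ≠ u.take t) ∨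
      u.Nodup ∨
      k = 2 ∨
      (∃ x ∈ u, x ∉ v) ∨
      ((∀ w w' : List α, w ≠ [] → u ≠ w ++ w' ++ w) ∧
        (∀ s s' : List α, s ≠ [] → v ≠ s ++ s' ++ s))) :
    SgpBiautomatic R ∧ SgpPrefixAutomatic R := by
  subst hRdef
  have hlen : u.length = v.length := hu.trans hv.symm
  have hu2 : 2 ≤ u.length := by omega
  have hC : Cond u v := by
    subst hu
    exact hcond
  have hU : ∀ x ∈ Irr u, ∀ y ∈ Irr u, WordEq {(u, v)} x y → x = y := by
    intro x hx y hy h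
    exact (hGSB y hy.1).unique ⟨hx, h⟩ ⟨hy, WordEq.refl' y⟩
  have hG := good_of_cond hlen huv hU hC
  have hR := main_right hlen hu2 huv hG hU
  have hL := main_left hlen hu2 huv hC hU
  have hne : ∀ w ∈ Irr u, w ≠ [] := fun w hw => hw.1
  have honto : ∀ w : List α, w ≠ [] → ∃ x ∈ Irr u, WordEq {(u, v)} x w := by
    intro w hw
    obtain ⟨l, hl, -⟩ := hGSB w hw
    exact ⟨l, hl.1, hl.2⟩
  have hD := isReg_diag (isReg_Irr u)
  have hEqR : IsReg {p | ∃ x ∈ Irr u, ∃ y ∈ Irr u, WordEq {(u, v)} x y ∧ p = padR x y} := by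
    convert hD using 1
    ext p
    constructor
    · rintro ⟨x, hx, y, hy, hxy, rfl⟩
      obtain rfl := hU x hx y hy hxy
      exact ⟨x, hx, rfl⟩
    · rintro ⟨x, hx, rfl⟩
      exact ⟨x, hx, x, hx, WordEq.refl' x, rfl⟩
  have hEqL : IsReg {p | ∃ x ∈ Irr u, ∃ y ∈ Irr u, WordEq {(u, v)} x y ∧ p = padL x y} := by
    convert hD using 1
    ext p
    constructor
    · rintro ⟨x, hx, y, hy, hxy, rfl⟩
      obtain rfl := hU x hx y hy hxy
      exact ⟨x, hx, padL_eq_padR rfl⟩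
    · rintro ⟨x, hx, rfl⟩
      exact ⟨x, hx, x, hx, WordEq.refl' x, (padL_eq_padR rfl).symm⟩
  have hPre : IsReg {p | ∃ x ∈ Irr u, ∃ y : List α, (∃ z ∈ Irr u, y <+: z) ∧
      WordEq {(u, v)} x y ∧ p = padR x y} := by
    convert hEqR using 1
    ext p
    constructor
    · rintro ⟨x, hx, y, ⟨z, hz, hyz⟩, hxy, rfl⟩
      refine ⟨x, hx, y, ⟨?_, fun h => hz.2 (h.trans hyz.isInfix)⟩, hxy, rfl⟩
      rintro rfl
      exact hx.1 (List.eq_nil_of_length_eq_zero (by simpa using hxy.len hlen))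
    · rintro ⟨x, hx, y, hy, hxy, rfl⟩
      exact ⟨x, hx, y, ⟨y, hy, List.prefix_refl y⟩, hxy, rfl⟩
  refine ⟨⟨α, inferInstance, fun a => [a], Irr u, ?_⟩, ⟨α, inferInstance, fun a => [a], Irr u, ?_⟩⟩
  · constructor <;> try simp only [expandW_single]
    · simp
    · exact isReg_Irr u
    · exact hne
    · exact honto
    · exact hEqR
    · exact hEqL
    · exact fun b => (hR b).1
    · exact fun b => (hL b).1
    · exact fun b => (hR b).2
    · exact fun b => (hL b).2
  · refine ⟨?_, ?_⟩
    · constructor <;> try simp only [expandW_single]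
      · simp
      · exact isReg_Irr u
      · exact hne
      · exact honto
      · exact hEqR
      · exact fun b => (hR b).1
    · simp only [expandW_single]
      exact hPre
end

section
/- Let S = sgp⟨a_1,…,a_n | a_{i_1}a_{i_2}⋯a_{i_k} = ε⟩ be the monoid presented by A = {a_1,…,a_n} with a single relation w = ε where w = a_{i_1}⋯a_{i_k} has length k ≥ 2, and suppose {w = ε} is a Gröbner–Shirshov basis, equivalently that the set of words of A^* containing no occurrence of w as a factor contains exactly one representative of each element of S. Then S is biautomatic. -/
namespace BiautoAux

open List

theorem reg_congr {γ : Type*} {L L' : Set (List γ)} (h : IsReg L)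
    (e : ∀ p, p ∈ L' ↔ p ∈ L) : IsReg L' := by
  have : L' = L := Set.ext e
  rwa [this]

theorem reg_of_congr {γ K : Type*} (f : List γ → K) (hfin : (Set.range f).Finite)
    (hstep : ∀ x y a, f x = f y → f (x ++ [a]) = f (y ++ [a]))
    (L : Set (List γ)) (hL : ∀ x y, f x = f y → (x ∈ L ↔ y ∈ L)) : IsReg L := by
  have happ : ∀ z x y, f x = f y → f (x ++ z) = f (y ++ z) := by
    intro z
    induction z with
    | nil => intro x y h; simpa using h
    | cons a z ih =>
      intro x y h
      have := ih _ _ (hstep x y a h)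
      simpa using this
  apply Language.IsRegular.of_finite_range_leftQuotient
  have hq : ∀ x y, f x = f y →
      Language.leftQuotient (L : Language γ) x = Language.leftQuotient (L : Language γ) y := by
    intro x y h
    ext z
    exact hL _ _ (happ z x y h)
  classical
  have : Set.range (Language.leftQuotient (L : Language γ)) ⊆
      (fun k => if h : ∃ x, f x = k then
        Language.leftQuotient (L : Language γ) h.choose else 0) '' Set.range f := by
    rintro _ ⟨x, rfl⟩
    refine ⟨f x, ⟨x, rfl⟩, ?_⟩
    have h : ∃ y, f y = f x := ⟨x, rfl⟩
    simp only [h, dif_pos]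
    exact hq _ _ h.choose_spec
  exact (hfin.image _).subset this

theorem reg_of_foldl {γ K : Type*} (step : K → γ → K) (s : K) (T : Set K) (hT : T.Finite)
    (hs : s ∈ T) (hstep : ∀ k ∈ T, ∀ a, step k a ∈ T) (F : Set K) :
    IsReg {p : List γ | p.foldl step s ∈ F} := by
  apply reg_of_congr (fun p => p.foldl step s)
  · apply hT.subset
    rintro _ ⟨p, rfl⟩
    dsimp only
    induction p using List.reverseRecOn with
    | nil => exact hs
    | append_singleton p a ih => simpa using hstep _ ih a
  · intro x y a h
    simpa using congrArg (fun k => step k a) h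
  · intro x y h
    exact iff_of_eq (congrArg (· ∈ F) h)

theorem reg_factor {γ : Type*} (w : List γ) : IsReg {x : List γ | w <:+: x} := by
  apply reg_of_congr
    (fun x => ((w <:+: x : Prop), fun i : Fin (w.length + 1) => (w.take i <:+ x : Prop)))
  · exact Set.toFinite _
  · intro x y a h
    simp only [Prod.mk.injEq, funext_iff, eq_iff_iff] at h ⊢
    obtain ⟨h1, h2⟩ := h
    have key : ∀ i : Fin (w.length + 1), w.take i <:+ x ++ [a] ↔ w.take i <:+ y ++ [a] := by
      intro i
      rw [suffix_concat_iff, suffix_concat_iff]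
      have aux : ∀ t, w.take i = t ++ [a] → (t <:+ x ↔ t <:+ y) := by
        intro t ht
        have hl : t.length < w.length + 1 := by
          have := congrArg List.length ht
          simp at this
          omega
        have e : w.take t.length = t := by
          have h3 : t <+: w := by
            have : t <+: w.take i := ⟨[a], ht.symm⟩
            exact this.trans ⟨w.drop i, List.take_append_drop _ _⟩
          exact (prefix_iff_eq_take.1 h3).symm
        have := h2 ⟨t.length, hl⟩
        simpa [e] using this
      constructor
      · rintro (h | ⟨t, ht, h⟩)
        · exact Or.inl h
        · exact Or.inr ⟨t, ht, (aux t ht).1 h⟩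
      · rintro (h | ⟨t, ht, h⟩)
        · exact Or.inl h
        · exact Or.inr ⟨t, ht, (aux t ht).2 h⟩
    refine ⟨?_, key⟩
    rw [infix_concat_iff, infix_concat_iff, h1]
    have := key ⟨w.length, by omega⟩
    simp only [take_length] at this
    rw [this]
  · intro x y h
    simp only [Prod.mk.injEq, eq_iff_iff] at h
    exact h.1

theorem reg_filterMap {γ δ : Type*} (f : γ → Option δ) (L : Set (List δ)) (hL : IsReg L) :
    IsReg {p : List γ | p.filterMap f ∈ L} := by
  obtain ⟨σ, _, M, rfl⟩ := hL
  have h := reg_of_foldl (γ := γ) (fun s c => match f c with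
    | none => s
    | some a => M.step s a) M.start Set.univ (Set.toFinite _) trivial (fun _ _ _ => trivial) M.accept
  convert h using 2
  ext p
  have : ∀ (p : List γ) s, M.evalFrom s (p.filterMap f) = p.foldl (fun s c => match f c with
    | none => s
    | some a => M.step s a) s := by
    intro p
    induction p with
    | nil => intro s; rfl
    | cons c p ih =>
      intro s
      rw [List.foldl_cons, ← ih]
      cases hc : f c <;> simp [hc, DFA.evalFrom]
  rw [← this]
  rfl

theorem reg_singleton {γ : Type*} (w : List γ) : IsReg ({w} : Set (List γ)) := by
  have h := reg_of_foldl (γ := γ) (K := Option (List γ)) (open Classical in fun s c => match s with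
    | some (b :: r) => if b = c then some r else none
    | _ => none) (some w) (insert none (some '' {r | r <:+ w})) (by
      apply Set.Finite.insert
      apply Set.Finite.image
      have : {r | r <:+ w} = {r | r ∈ w.tails} := by ext; simp
      rw [this]
      exact List.finite_toSet _) (by simp) (by
      intro k hk a
      rcases k with _ | _ | ⟨b, r⟩
      · simp
      · simp
      · simp only [Set.mem_insert_iff, reduceCtorEq, Set.mem_image, Set.mem_ofPred_eq,
          Option.some.injEq, exists_eq_right, false_or] at hk
        by_cases hb : b = a
        · simp only [hb, if_true, Set.mem_insert_iff, reduceCtorEq, Set.mem_image,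
            Set.mem_ofPred_eq, Option.some.injEq, exists_eq_right, false_or]
          exact (suffix_cons b r).trans hk
        · simp [hb]) {some []}
  convert h using 2
  ext p
  classical
  have hn : ∀ p : List γ, p.foldl (fun (s : Option (List γ)) c => match s with
    | some (b :: r) => if b = c then some r else none
    | _ => none) none = none := by
    intro p; induction p with
    | nil => rfl
    | cons c p ih => simpa using ih
  have : ∀ (p r : List γ), p = r ↔ p.foldl (fun (s : Option (List γ)) c => match s with
    | some (b :: r) => if b = c then some r else none
    | _ => none) (some r) = some [] := by
    intro p
    induction p with
    | nil => intro r; simp [eq_comm]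
    | cons c p ih =>
      intro r
      rcases r with _ | ⟨b, r⟩
      · simp [hn]
      · by_cases hb : b = c
        · simp [hb, ih]
        · simp only [List.foldl_cons, hb, if_false, hn]
          simp [Ne.symm hb]
  simp only [Set.mem_singleton_iff, Set.mem_ofPred_eq]
  rw [this]
  

/-! ### Padding -/

theorem padR_cons {γ : Type*} (a b : γ) (x y : List γ) :
    padR (a :: x) (b :: y) = (some a, some b) :: padR x y := by
  simp [padR]

theorem padR_nil_left {γ : Type*} (y : List γ) :
    padR [] y = y.map (fun b => (none, some b)) := by
  induction y with
  | nil => rfl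
  | cons b y ih => simpa [padR, List.replicate_succ] using ih

theorem padR_nil_right {γ : Type*} (y : List γ) :
    padR y [] = y.map (fun b => (some b, none)) := by
  induction y with
  | nil => rfl
  | cons b y ih => simpa [padR, List.replicate_succ] using ih

theorem padR_fst {γ : Type*} (x y : List γ) : (padR x y).filterMap Prod.fst = x := by
  induction x generalizing y with
  | nil => rw [padR_nil_left]; induction y <;> simp_all
  | cons a x ih =>
    rcases y with _ | ⟨b, y⟩
    · rw [padR_nil_right]; simp [List.filterMap_map]
    · simp [padR_cons, ih]

theorem padR_swap {γ : Type*} (x y : List γ) : (padR x y).map Prod.swap = padR y x := by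
  induction x generalizing y with
  | nil => simp [padR_nil_left, padR_nil_right]
  | cons a x ih =>
    rcases y with _ | ⟨b, y⟩
    · simp [padR_nil_left, padR_nil_right]
    · simp [padR_cons, ih]

theorem padR_snd {γ : Type*} (x y : List γ) : (padR x y).filterMap Prod.snd = y := by
  rw [← padR_swap, List.filterMap_map]
  exact padR_fst y x

theorem padL_eq {γ : Type*} (x y : List γ) :
    padL x y = (padR x.reverse y.reverse).reverse := by
  unfold padL padR
  simp only [List.zip, List.length_reverse]
  rw [List.reverse_zipWith (by simp; omega)]
  simp

theorem reg_swap {γ : Type*} (L : Set (List (Option γ × Option γ))) (h : IsReg L) :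
    IsReg {p | p.map Prod.swap ∈ L} := by
  have := reg_filterMap (fun c : Option γ × Option γ => some c.swap) L h
  refine reg_congr this fun p => ?_
  show p.map Prod.swap ∈ L ↔ p.filterMap (fun c => some c.swap) ∈ L
  rw [← List.filterMap_eq_map']

/-- Relations on words recognized synchronously with either padding. -/
structure BiReg {γ : Type*} (Q : List γ → List γ → Prop) : Prop where
  r : IsReg {p | ∃ x y, Q x y ∧ p = padR x y}
  l : IsReg {p | ∃ x y, Q x y ∧ p = padL x y}

/-- only right padding -/
def RReg {γ : Type*} (Q : List γ → List γ → Prop) : Prop :=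
  IsReg {p | ∃ x y, Q x y ∧ p = padR x y}

theorem biReg_of {γ : Type*} {Q : List γ → List γ → Prop} (h1 : RReg Q)
    (h2 : RReg (fun x y => Q x.reverse y.reverse)) : BiReg Q := by
  refine ⟨h1, ?_⟩
  have := Language.IsRegular.reverse h2
  refine reg_congr this fun p => ?_
  constructor
  · rintro ⟨x, y, h, rfl⟩
    refine ⟨x.reverse, y.reverse, by simpa using h, ?_⟩
    simp [padL_eq]
  · rintro ⟨x, y, h, hp⟩
    refine ⟨_, _, h, ?_⟩
    rw [padL_eq, List.reverse_reverse, List.reverse_reverse, ← hp, List.reverse_reverse]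

theorem RReg.swap {γ : Type*} {Q : List γ → List γ → Prop} (h : RReg Q) :
    RReg (fun x y => Q y x) := by
  have := reg_swap _ h
  unfold RReg
  convert this using 2
  ext p
  constructor
  · rintro ⟨x, y, h, rfl⟩
    exact ⟨y, x, h, padR_swap _ _⟩
  · rintro ⟨x, y, h, hp⟩
    refine ⟨y, x, h, ?_⟩
    rw [← padR_swap, ← hp]; simp

theorem RReg.or {γ : Type*} {Q Q' : List γ → List γ → Prop} (h : RReg Q) (h' : RReg Q') :
    RReg (fun x y => Q x y ∨ Q' x y) := by
  have := Language.IsRegular.add h h'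
  unfold RReg
  refine reg_congr this fun p => ?_
  constructor
  · rintro ⟨x, y, h | h, rfl⟩
    · exact Or.inl ⟨x, y, h, rfl⟩
    · exact Or.inr ⟨x, y, h, rfl⟩
  · rintro (⟨x, y, h, rfl⟩ | ⟨x, y, h, rfl⟩)
    · exact ⟨x, y, Or.inl h, rfl⟩
    · exact ⟨x, y, Or.inr h, rfl⟩

theorem RReg.restrict {γ : Type*} {Q : List γ → List γ → Prop} (h : RReg Q) (L : Set (List γ))
    (hL : IsReg L) : RReg (fun x y => x ∈ L ∧ y ∈ L ∧ Q x y) := by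
  have := Language.IsRegular.inf (Language.IsRegular.inf h (reg_filterMap Prod.fst L hL))
    (reg_filterMap Prod.snd L hL)
  unfold RReg
  refine reg_congr this fun p => ?_
  constructor
  · rintro ⟨x, y, ⟨hx, hy, h⟩, rfl⟩
    refine ⟨⟨⟨x, y, h, rfl⟩, ?_⟩, ?_⟩
    · show _ ∈ L
      rwa [padR_fst]
    · show _ ∈ L
      rwa [padR_snd]
  · rintro ⟨⟨⟨x, y, h, rfl⟩, hx⟩, hy⟩
    refine ⟨x, y, ⟨?_, ?_, h⟩, rfl⟩
    · have : _ ∈ L := hx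
      rwa [padR_fst] at this
    · have : _ ∈ L := hy
      rwa [padR_snd] at this

theorem RReg.empty {γ : Type*} : RReg (fun _ _ : List γ => False) := by
  have := reg_of_foldl (γ := Option γ × Option γ) (fun (s : Unit) _ => s) () Set.univ
    (Set.toFinite _) trivial (fun _ _ _ => trivial) ∅
  unfold RReg
  convert this using 2
  ext p
  simp

theorem RReg.pair {γ : Type*} (u v : List γ) : RReg (fun x y => x = u ∧ y = v) := by
  unfold RReg
  convert reg_singleton (padR u v) using 2
  ext p
  simp

open Classical in
/-- The buffer automaton. -/
noncomputable def bstep {γ : Type*} (n : ℕ) (c : List γ → γ → List γ) :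
    Option (List γ) → Option γ × Option γ → Option (List γ)
  | some r, (some a, some b) =>
      if r.length = n ∧ ∃ r', c r a = b :: r' then some (c r a).tail else none
  | some (b' :: r), (none, some b) => if b' = b then some r else none
  | _, _ => none

theorem bstep_none {γ : Type*} (n : ℕ) (c : List γ → γ → List γ) (p : List (Option γ × Option γ)) :
    p.foldl (bstep n c) none = none := by
  induction p with
  | nil => rfl
  | cons a p ih => rw [List.foldl_cons]; exact ih

theorem bstep_short {γ : Type*} (n : ℕ) (c : List γ → γ → List γ) (p : List (Option γ × Option γ)) :
    ∀ r : List γ, r.length < n →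
      (p.foldl (bstep n c) (some r) = some [] ↔ p = padR [] r) := by
  induction p with
  | nil => intro r _; simp [padR_nil_left]
  | cons d p ih =>
    intro r hr
    rw [padR_nil_left, List.foldl_cons]
    rcases d with ⟨_ | a, _ | b⟩
    · rcases r with _ | ⟨b', r⟩ <;> simp [bstep, bstep_none]
    · rcases r with _ | ⟨b', r⟩
      · simp [bstep, bstep_none]
      · by_cases hb : b' = b
        · have := ih r (by simp at hr; omega)
          simp [bstep, hb, this, padR_nil_left]
        · simp [bstep, hb, bstep_none, Ne.symm hb]
    · rcases r with _ | ⟨b', r⟩ <;> simp [bstep, bstep_none]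
    · rcases r with _ | ⟨b', r⟩ <;> first
        | (have hn : ¬ (List.length _ = n) := hr.ne
           simp only [List.length_nil, List.length_cons] at hn
           simp [bstep, bstep_none, hn])


theorem bstep_full {γ : Type*} (n : ℕ) (c : List γ → γ → List γ)
    (F : List γ → List γ → List γ) (hF0 : ∀ r, F r [] = r)
    (hF : ∀ r a b r' x, c r a = b :: r' → F r (a :: x) = b :: F r' x)
    (hc : ∀ r a, (c r a).length = r.length + 1) (p : List (Option γ × Option γ)) :
    ∀ r : List γ, r.length = n →
      (p.foldl (bstep n c) (some r) = some [] ↔ ∃ x, p = padR x (F r x)) := by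
  induction p with
  | nil =>
    intro r hr
    constructor
    · intro h
      simp at h
      exact ⟨[], by simp [hF0, h, padR_nil_left]⟩
    · rintro ⟨x, hx⟩
      rcases x with _ | ⟨a, x⟩
      · rw [hF0, padR_nil_left] at hx
        simp at hx
        simp [hx]
      · obtain ⟨b, r', h'⟩ : ∃ b r', c r a = b :: r' :=
          List.exists_cons_of_length_eq_add_one (hc r a)
        rw [hF _ _ _ _ _ h', padR_cons] at hx
        simp at hx
  | cons d p ih =>
    intro r hr
    have main : (∃ x, d :: p = padR x (F r x)) ↔ (d :: p = padR [] r) ∨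
        ∃ a b r', c r a = b :: r' ∧ d = (some a, some b) ∧ ∃ x, p = padR x (F r' x) := by
      constructor
      · rintro ⟨x, hx⟩
        rcases x with _ | ⟨a, x⟩
        · rw [hF0] at hx; exact Or.inl hx
        · obtain ⟨b, r', h'⟩ : ∃ b r', c r a = b :: r' :=
            List.exists_cons_of_length_eq_add_one (hc r a)
          rw [hF _ _ _ _ _ h', padR_cons] at hx
          simp at hx
          exact Or.inr ⟨a, b, r', h', hx.1, x, hx.2⟩
      · rintro (h | ⟨a, b, r', h', rfl, x, rfl⟩)
        · exact ⟨[], by rw [hF0, h]⟩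
        · exact ⟨a :: x, by rw [hF _ _ _ _ _ h', padR_cons]⟩
    rw [main, List.foldl_cons]
    rcases d with ⟨_ | a, _ | b⟩
    · rcases r with _ | ⟨b', r⟩ <;> simp [bstep, bstep_none, padR_nil_left]
    · rcases r with _ | ⟨b', r⟩
      · simp [bstep, bstep_none, padR_nil_left]
      · by_cases hb : b' = b
        · have := bstep_short n c p r (by simp at hr; omega)
          simp [bstep, hb, this, padR_nil_left]
        · simp [bstep, hb, bstep_none, Ne.symm hb, padR_nil_left]
    · rcases r with _ | ⟨b', r⟩ <;> simp [bstep, bstep_none, padR_nil_left]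
    · by_cases h : ∃ r', c r a = b :: r'
      · obtain ⟨r', h'⟩ := h
        have hl : r'.length = n := by
          have := hc r a
          rw [h'] at this
          simp at this
          omega
        have e : bstep n c (some r) (some a, some b) = some r' := by
          unfold bstep
          simp [hr, h']
        rw [e, ih r' hl]
        constructor
        · intro h; exact Or.inr ⟨a, b, r', h', rfl, h⟩
        · rintro (h | ⟨a', b', r'', h'', h3, h4⟩)
          · rcases r with _ | ⟨b', r⟩ <;> simp [padR_nil_left] at h
          · simp at h3
            obtain ⟨rfl, rfl⟩ := h3
            rw [h'] at h''
            simp at h''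
            rwa [h'']
      · have e : bstep n c (some r) (some a, some b) = none := by
          unfold bstep
          simp only [h, and_false, if_false]
        rw [e, bstep_none]
        simp only [reduceCtorEq, false_iff]
        rintro (h4 | ⟨a', b', r'', h'', h3, h4⟩)
        · rcases r with _ | ⟨b', r⟩ <;> simp [padR_nil_left] at h4
        · simp at h3
          obtain ⟨rfl, rfl⟩ := h3
          exact h ⟨_, h''⟩

theorem rreg_buffer {γ : Type*} [Finite γ] (c : List γ → γ → List γ)
    (F : List γ → List γ → List γ) (hF0 : ∀ r, F r [] = r)
    (hF : ∀ r a b r' x, c r a = b :: r' → F r (a :: x) = b :: F r' x)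
    (hc : ∀ r a, (c r a).length = r.length + 1) (u : List γ) :
    RReg (fun x y => y = F u x) := by
  have h := reg_of_foldl (bstep u.length c) (some u)
    (insert none (some '' {r | r.length ≤ u.length}))
    (((List.finite_length_le γ _).image _).insert _) (by simp) (by
      intro k hk d
      rcases k with _ | r
      · simp [bstep]
      simp only [Set.mem_insert_iff, reduceCtorEq, Set.mem_image, Set.mem_ofPred_eq,
        Option.some.injEq, exists_eq_right, false_or] at hk
      rcases d with ⟨_ | a, _ | b⟩
      · rcases r with _ | ⟨b', r⟩ <;> simp [bstep]
      · rcases r with _ | ⟨b', r⟩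
        · simp [bstep]
        · simp at hk
          by_cases hb : b' = b
          · simp [bstep, hb]; omega
          · simp [bstep, hb]
      · rcases r with _ | ⟨b', r⟩ <;> simp [bstep]
      · by_cases h : r.length = u.length ∧ ∃ r', c r a = b :: r'
        · unfold bstep
          simp [h, hc]
        · unfold bstep
          simp only [h, if_false]
          simp) {some []}
  unfold RReg
  convert h using 2
  ext p
  simp only [Set.mem_singleton_iff]
  rw [bstep_full u.length c F hF0 hF hc p u rfl]
  constructor
  · rintro ⟨x, y, rfl, h⟩; exact ⟨x, h⟩
  · rintro ⟨x, h⟩; exact ⟨x, _, rfl, h⟩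

theorem rreg_append {γ : Type*} [Finite γ] (u : List γ) : RReg (fun x y => y = x ++ u) :=
  rreg_buffer (fun r a => a :: r) (fun r x => x ++ r) (by simp) (by
    intro r a b r' x h
    simp at h
    simp [h]) (by simp) u

theorem rreg_prepend {γ : Type*} [Finite γ] (u : List γ) : RReg (fun x y => y = u ++ x) :=
  rreg_buffer (fun r a => r ++ [a]) (fun r x => r ++ x) (by simp) (by
    intro r a b r' x h
    rw [← List.cons_append, ← h]; simp) (by simp) u

theorem BiReg.congr {γ : Type*} {Q Q' : List γ → List γ → Prop} (h : BiReg Q)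
    (e : ∀ x y, Q' x y ↔ Q x y) : BiReg Q' := by
  have : Q' = Q := by ext; apply e
  rwa [this]

theorem BiReg.rr {γ : Type*} {Q : List γ → List γ → Prop} (h : BiReg Q) :
    RReg (fun x y => Q x.reverse y.reverse) := by
  have := Language.IsRegular.reverse h.l
  unfold RReg
  refine reg_congr this fun p => ?_
  constructor
  · rintro ⟨x, y, h, rfl⟩
    exact ⟨_, _, h, by simp [padL_eq]⟩
  · rintro ⟨x, y, h, hp⟩
    refine ⟨x.reverse, y.reverse, by simpa using h, ?_⟩
    rw [padL_eq] at hp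
    exact List.reverse_injective hp

theorem BiReg.or {γ : Type*} {Q Q' : List γ → List γ → Prop} (h : BiReg Q) (h' : BiReg Q') :
    BiReg (fun x y => Q x y ∨ Q' x y) :=
  biReg_of (RReg.or h.r h'.r) (RReg.or h.rr h'.rr)

theorem BiReg.swap {γ : Type*} {Q : List γ → List γ → Prop} (h : BiReg Q) :
    BiReg (fun x y => Q y x) :=
  biReg_of (RReg.swap h.r) (RReg.swap h.rr)

theorem BiReg.restrict {γ : Type*} {Q : List γ → List γ → Prop} (h : BiReg Q) (L : Set (List γ))
    (hL : IsReg L) : BiReg (fun x y => x ∈ L ∧ y ∈ L ∧ Q x y) :=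
  biReg_of (RReg.restrict h.r L hL)
    (RReg.restrict h.rr {x | x.reverse ∈ L} (Language.IsRegular.reverse hL))

theorem BiReg.pair {γ : Type*} (u v : List γ) : BiReg (fun x y => x = u ∧ y = v) :=
  biReg_of (RReg.pair u v) (by
    have := RReg.pair u.reverse v.reverse
    simpa only [List.reverse_eq_iff] using this)

theorem BiReg.and_const {γ : Type*} {Q : List γ → List γ → Prop} (h : BiReg Q) (P : Prop) :
    BiReg (fun x y => P ∧ Q x y) := by
  by_cases hP : P
  · simpa [hP] using h
  · simp only [hP, false_and]
    exact biReg_of RReg.empty RReg.empty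

theorem BiReg.append {γ : Type*} [Finite γ] (u : List γ) : BiReg (fun x y => y = x ++ u) :=
  biReg_of (rreg_append u) (by
    have := rreg_prepend u.reverse
    simpa only [List.reverse_eq_iff, List.reverse_append, List.reverse_reverse] using this)

theorem BiReg.prepend {γ : Type*} [Finite γ] (u : List γ) : BiReg (fun x y => y = u ++ x) :=
  biReg_of (rreg_prepend u) (by
    have := rreg_append u.reverse
    simpa only [List.reverse_eq_iff, List.reverse_append, List.reverse_reverse] using this)

/-! ### The word problem -/

theorem wordEq_ctx {α : Type*} {R : Set (List α × List α)} {x y : List α} (h : WordEq R x y)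
    (p s : List α) : WordEq R (p ++ x ++ s) (p ++ y ++ s) := by
  induction h with
  | rel x y h =>
    obtain ⟨p', u, v, s', h, rfl, rfl⟩ := h
    exact Relation.EqvGen.rel _ _ ⟨p ++ p', u, v, s' ++ s, h, by simp, by simp⟩
  | refl => exact Relation.EqvGen.refl _
  | symm _ _ _ ih => exact ih.symm
  | trans _ _ _ _ _ ih1 ih2 => exact ih1.trans _ _ _ ih2

theorem wordEq_w {α : Type*} (w p s : List α) :
    WordEq {(w, [])} (p ++ w ++ s) (p ++ s) :=
  Relation.EqvGen.rel _ _ ⟨p, w, [], s, rfl, rfl, by simp⟩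

theorem expandW_id {α : Type*} (x : List α) : expandW (fun a => [a]) x = x := by
  induction x with
  | nil => rfl
  | cons a x ih => simpa [expandW] using ih

section
variable {α : Type} (w : List α)

/-- The language of representatives. -/
def LL (w : List α) : Set (List α) := {x | x = w ∨ (x ≠ [] ∧ ¬ w <:+: x)}

theorem uniq (hG : ∀ x : List α, ∃! l : List α, (¬ w <:+: l) ∧ WordEq {(w, [])} l x) {x y : List α} (hx : ¬ w <:+: x) (hy : ¬ w <:+: y) (h : WordEq {(w, [])} x y) :
    x = y :=
  (hG y).unique ⟨hx, h⟩ ⟨hy, Relation.EqvGen.refl _⟩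

theorem irr_nil (hw : 2 ≤ w.length) : ¬ w <:+: [] := by
  intro h
  have := h.length_le
  simp at this
  simp [this] at hw

theorem exists_rep (hw : 2 ≤ w.length) {x : List α} (hx : x ∈ LL w) :
    ∃ X, ¬ w <:+: X ∧ WordEq {(w, [])} X x ∧ ((x = w ∧ X = []) ∨ (X = x ∧ X ≠ [])) := by
  rcases hx with rfl | ⟨h1, h2⟩
  · exact ⟨[], irr_nil _ hw, (by have := wordEq_w x [] []; simp only [List.append_nil, List.nil_append] at this; exact this.symm), Or.inl ⟨rfl, rfl⟩⟩
  · exact ⟨x, h2, Relation.EqvGen.refl _, Or.inr ⟨rfl, h1⟩⟩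

theorem eq_char (hw : 2 ≤ w.length)
    (hG : ∀ x : List α, ∃! l : List α, (¬ w <:+: l) ∧ WordEq {(w, [])} l x) {x y : List α} (hx : x ∈ LL w) (hy : y ∈ LL w) :
    WordEq {(w, [])} x y ↔ y = x ++ [] := by
  rw [List.append_nil]
  constructor
  · intro h
    obtain ⟨X, hX, hXx, hX'⟩ := exists_rep w hw hx
    obtain ⟨Y, hY, hYy, hY'⟩ := exists_rep w hw hy
    have := uniq w hG hX hY ((hXx.trans _ _ _ h).trans _ _ _ hYy.symm)
    subst this
    rcases hX' with ⟨rfl, h1⟩ | ⟨h1, h2⟩ <;> rcases hY' with ⟨rfl, h3⟩ | ⟨h3, h4⟩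
    · rfl
    · exact absurd h1 h4
    · exact absurd h3 h2
    · rw [← h1, ← h3]
  · rintro rfl; exact Relation.EqvGen.refl _

theorem mulR_char (hw : 2 ≤ w.length)
    (hG : ∀ x : List α, ∃! l : List α, (¬ w <:+: l) ∧ WordEq {(w, [])} l x) (a : α) {x y : List α} (hx : x ∈ LL w) (hy : y ∈ LL w) :
    WordEq {(w, [])} (x ++ [a]) y ↔ (y = x ++ [a] ∨
      (w = w.dropLast ++ [a] ∧ x = y ++ w.dropLast) ∨ (x = w ∧ y = [a]) ∨
      (w = w.dropLast ++ [a] ∧ (x = w.dropLast ∧ y = w))) := by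
  constructor
  · intro h
    obtain ⟨X, hX, hXx, hX'⟩ := exists_rep w hw hx
    obtain ⟨Y, hY, hYy, hY'⟩ := exists_rep w hw hy
    have h1 : WordEq {(w, [])} (X ++ [a]) Y := by
      have := wordEq_ctx hXx [] [a]
      simp only [List.nil_append] at this
      exact (this.trans _ _ _ h).trans _ _ _ hYy.symm
    have key : Y = X ++ [a] ∨ X ++ [a] = Y ++ w := by
      by_cases hr : w <:+: X ++ [a]
      · right
        rw [infix_concat_iff] at hr
        rcases hr with ⟨Z, hZ⟩ | hr
        · have hZX : Z <:+: X := by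
            have hwne : w ≠ [] := by rintro rfl; simp at hw
            have e := congrArg List.dropLast hZ
            rw [List.dropLast_append_of_ne_nil hwne, List.dropLast_concat] at e
            exact ⟨[], w.dropLast, by simpa using e⟩
          have hZi : ¬ w <:+: Z := fun h => hX (h.trans hZX)
          have h2 : WordEq {(w, [])} Z Y := by
            have := wordEq_w w Z []
            simp only [List.append_nil] at this
            rw [hZ] at this
            exact this.symm.trans _ _ _ h1
          rw [← uniq w hG hZi hY h2, hZ]
        · exact absurd hr hX
      · exact Or.inl (uniq w hG hr hY h1).symm
    have aux : ∀ Y : List α, X ++ [a] = Y ++ w →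
        w = w.dropLast ++ [a] ∧ X = Y ++ w.dropLast := by
      intro Y h
      have hwne : w ≠ [] := by rintro rfl; simp at hw
      have e := congrArg List.dropLast h
      rw [List.dropLast_append_of_ne_nil hwne, List.dropLast_concat] at e
      refine ⟨?_, e⟩
      rw [e, List.append_assoc] at h
      exact (List.append_cancel_left h).symm
    rcases hX' with ⟨hx1, h2⟩ | ⟨h2, h3⟩ <;> rcases hY' with ⟨hy1, h4⟩ | ⟨h4, h5⟩
    · subst h2 h4
      rcases key with key | key
      · simp at key
      · have := congrArg List.length key
        simp at this; omega
    · subst h2 h4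
      rcases key with key | key
      · exact Or.inr (Or.inr (Or.inl ⟨hx1, key⟩))
      · have := congrArg List.length key
        simp at this; omega
    · subst h2 h4
      rcases key with key | key
      · simp at key
      · obtain ⟨e1, e2⟩ := aux _ key
        exact Or.inr (Or.inr (Or.inr ⟨e1, by simpa using e2, hy1⟩))
    · subst h2 h4
      rcases key with key | key
      · exact Or.inl key
      · exact Or.inr (Or.inl (aux _ key))
  · rintro (rfl | ⟨h, rfl⟩ | ⟨rfl, rfl⟩ | ⟨h, rfl, rfl⟩)
    · exact Relation.EqvGen.refl _
    · have := wordEq_w w y []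
      rw [List.append_assoc, ← h]
      simpa using this
    · simpa using wordEq_w x [] [a]
    · rw [← h]; exact Relation.EqvGen.refl _

theorem mulL_char (hw : 2 ≤ w.length)
    (hG : ∀ x : List α, ∃! l : List α, (¬ w <:+: l) ∧ WordEq {(w, [])} l x) (a : α) {x y : List α} (hx : x ∈ LL w) (hy : y ∈ LL w) :
    WordEq {(w, [])} ([a] ++ x) y ↔ (y = [a] ++ x ∨
      (w = [a] ++ w.tail ∧ x = w.tail ++ y) ∨ (x = w ∧ y = [a]) ∨
      (w = [a] ++ w.tail ∧ (x = w.tail ∧ y = w))) := by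
  constructor
  · intro h
    obtain ⟨X, hX, hXx, hX'⟩ := exists_rep w hw hx
    obtain ⟨Y, hY, hYy, hY'⟩ := exists_rep w hw hy
    have h1 : WordEq {(w, [])} ([a] ++ X) Y := by
      have := wordEq_ctx hXx [a] []
      simp only [List.append_nil] at this
      exact (this.trans _ _ _ h).trans _ _ _ hYy.symm
    have hwne : w ≠ [] := by rintro rfl; simp at hw
    have aux : ∀ Y : List α, [a] ++ X = w ++ Y →
        w = [a] ++ w.tail ∧ X = w.tail ++ Y := by
      intro Y h
      obtain ⟨b, v, e⟩ := List.exists_cons_of_ne_nil hwne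
      rw [e] at h ⊢
      simp at h
      simp [h]
    have key : Y = [a] ++ X ∨ [a] ++ X = w ++ Y := by
      by_cases hr : w <:+: [a] ++ X
      · right
        rw [List.singleton_append, infix_cons_iff] at hr
        rcases hr with ⟨Z, hZ⟩ | hr
        · have hZX : Z <:+: X := ⟨w.tail, [], by simpa using (aux Z hZ.symm).2.symm⟩
          have hZi : ¬ w <:+: Z := fun h => hX (h.trans hZX)
          have h2 : WordEq {(w, [])} Z Y := by
            have := wordEq_w w [] Z
            simp only [List.nil_append] at this
            rw [hZ] at this
            exact this.symm.trans _ _ _ h1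
          rw [← uniq w hG hZi hY h2, hZ]; rfl
        · exact absurd hr hX
      · exact Or.inl (uniq w hG hr hY h1).symm
    rcases hX' with ⟨hx1, h2⟩ | ⟨h2, h3⟩ <;> rcases hY' with ⟨hy1, h4⟩ | ⟨h4, h5⟩
    · subst h2 h4
      rcases key with key | key
      · simp at key
      · have := congrArg List.length key
        simp at this; omega
    · subst h2 h4
      rcases key with key | key
      · exact Or.inr (Or.inr (Or.inl ⟨hx1, key⟩))
      · have := congrArg List.length key
        simp at this; omega
    · subst h2 h4
      rcases key with key | key
      · simp at key
      · obtain ⟨e1, e2⟩ := aux _ key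
        exact Or.inr (Or.inr (Or.inr ⟨e1, by simpa using e2, hy1⟩))
    · subst h2 h4
      rcases key with key | key
      · exact Or.inl key
      · exact Or.inr (Or.inl (aux _ key))
  · rintro (rfl | ⟨h, rfl⟩ | ⟨rfl, rfl⟩ | ⟨h, rfl, rfl⟩)
    · exact Relation.EqvGen.refl _
    · have := wordEq_w w [] y
      rw [← List.append_assoc, ← h]
      simpa using this
    · simpa using wordEq_w x [a] []
    · rw [← h]; exact Relation.EqvGen.refl _

theorem LL_reg : IsReg (LL w) := by
  have h := Language.IsRegular.add (reg_singleton w)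
    (Language.IsRegular.inf (Language.IsRegular.compl (reg_singleton ([] : List α)))
      (Language.IsRegular.compl (reg_factor w)))
  exact h

end

end BiautoAux

open BiautoAux in
/-- let `S = sgp⟨α ∣ w = ε⟩` be the monoid presented by a single
relation `w = ε` with `|w| = k ≥ 2`, where `{w = ε}` is a Gröbner–Shirshov
basis (equivalently, the words with no factor `w` contain exactly one
representative of each element of `S`).  Then `S` is biautomatic. -/
theorem statement_5 {α : Type} [Fintype α] (k : ℕ) (hk : 2 ≤ k)
    (w : List α) (hw : w.length = k)
    (R : Set (List α × List α)) (hRdef : R = {(w, [])})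
    (hGSB : ∀ x : List α, ∃! l : List α, (¬ w <:+: l) ∧ WordEq R l x) :
    MonBiautomatic R := by
  subst hRdef hw
  have key : ∀ (P : List α → List α → Prop) (Q : List α → List α → Prop), BiReg Q →
      (∀ x ∈ LL w, ∀ y ∈ LL w, (P x y ↔ Q x y)) →
      IsReg {p | ∃ x ∈ LL w, ∃ y ∈ LL w, P x y ∧ p = padR x y} ∧
      IsReg {p | ∃ x ∈ LL w, ∃ y ∈ LL w, P x y ∧ p = padL x y} := by
    intro P Q hQ h
    have h1 := hQ.restrict (LL w) (LL_reg w)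
    constructor
    · convert h1.r using 2
      ext p
      constructor
      · rintro ⟨x, hx, y, hy, hP, rfl⟩
        exact ⟨x, y, ⟨hx, hy, (h x hx y hy).1 hP⟩, rfl⟩
      · rintro ⟨x, y, ⟨hx, hy, hP⟩, rfl⟩
        exact ⟨x, hx, y, hy, (h x hx y hy).2 hP, rfl⟩
    · convert h1.l using 2
      ext p
      constructor
      · rintro ⟨x, hx, y, hy, hP, rfl⟩
        exact ⟨x, y, ⟨hx, hy, (h x hx y hy).1 hP⟩, rfl⟩
      · rintro ⟨x, y, ⟨hx, hy, hP⟩, rfl⟩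
        exact ⟨x, hx, y, hy, (h x hx y hy).2 hP, rfl⟩
  have hE := key _ _ (BiReg.append []) (fun x hx y hy => eq_char w hk hGSB hx hy)
  have hR := fun a : α => key _ _ ((BiReg.append [a]).or
    ((((BiReg.append w.dropLast).swap).and_const (w = w.dropLast ++ [a])).or
      ((BiReg.pair w [a]).or ((BiReg.pair w.dropLast w).and_const (w = w.dropLast ++ [a])))))
    (fun x hx y hy => mulR_char w hk hGSB a hx hy)
  have hL := fun a : α => key _ _ ((BiReg.prepend [a]).or
    ((((BiReg.prepend w.tail).swap).and_const (w = [a] ++ w.tail)).or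
      ((BiReg.pair w [a]).or ((BiReg.pair w.tail w).and_const (w = [a] ++ w.tail)))))
    (fun x hx y hy => mulL_char w hk hGSB a hx hy)
  refine ⟨α, inferInstance, fun a => [a], LL w, ?_⟩
  constructor
  · exact LL_reg w
  · rintro x (rfl | h)
    · rintro rfl
      simp at hk
    · exact h.1
  · intro x
    obtain ⟨l, ⟨h1, h2⟩, -⟩ := hGSB x
    by_cases hl : l = []
    · refine ⟨w, Or.inl rfl, ?_⟩
      rw [expandW_id]
      subst hl
      have := wordEq_w w [] []
      simp only [List.append_nil, List.nil_append] at this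
      exact this.trans _ _ _ h2
    · exact ⟨l, Or.inr ⟨hl, h1⟩, by rwa [expandW_id]⟩
  all_goals simp only [expandW_id]
  · exact hE.1
  · exact hE.2
  · exact fun a => (hR a).1
  · exact fun a => (hL a).1
  · exact fun a => (hR a).2
  · exact fun a => (hL a).2
end

section
/- Let S = sgp^+⟨a_1,…,a_n | a_{i_1}a_{i_2}⋯a_{i_k} = x⟩ where A = {a_1,…,a_n}, k ≥ 2, x ∈ A, and suppose {a_{i_1}⋯a_{i_k} = x} is a Gröbner–Shirshov basis, equivalently that L = A^+ − A^*{a_{i_1}⋯a_{i_k}}A^* contains exactly one representative of each element of S. Then S is prefix-automatic. -/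
namespace St6

open Language

theorem reg_iff {τ : Type*} {L : Set (List τ)} :
    IsReg L ↔ (Set.range (Language.leftQuotient (L : Language τ))).Finite :=
  isRegular_iff_finite_range_leftQuotient

theorem reg_congr {τ : Type*} {L : Set (List τ)} {M : Language τ} (hM : M.IsRegular)
    (h : ∀ q, q ∈ L ↔ q ∈ M) : IsReg L := by
  have : (L : Language τ) = M := Set.ext h
  rw [← this] at hM
  exact hM

theorem mul_regular {τ : Type*} {L M : Language τ} (hL : L.IsRegular) (hM : M.IsRegular) :
    (L * M).IsRegular := by
  rw [isRegular_iff_finite_range_leftQuotient] at *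
  have hfin : (Set.image2 (fun (A : Language τ) (T : Set (Language τ)) =>
      ({y | y ∈ A * M ∨ ∃ B ∈ T, y ∈ B} : Language τ))
      (Set.range L.leftQuotient) (Set.powerset (Set.range M.leftQuotient))).Finite :=
    hL.image2 _ hM.powerset
  refine hfin.subset ?_
  rintro _ ⟨w, rfl⟩
  refine ⟨L.leftQuotient w, ⟨w, rfl⟩,
    {B | ∃ w1 w2, w = w1 ++ w2 ∧ w1 ∈ L ∧ B = M.leftQuotient w2}, ?_, ?_⟩
  · rintro _ ⟨w1, w2, _, _, rfl⟩
    exact ⟨w2, rfl⟩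
  · ext y
    constructor
    · rintro (h | ⟨_, ⟨w1, w2, rfl, h1, rfl⟩, h2⟩)
      · obtain ⟨a, ha, c, hc, rfl⟩ := Language.mem_mul.1 h
        exact Language.mem_mul.2 ⟨w ++ a, ha, c, hc, by simp⟩
      · exact Language.mem_mul.2 ⟨w1, h1, w2 ++ y, h2, by simp⟩
    · intro h
      obtain ⟨a, ha, c, hc, hac⟩ := Language.mem_mul.1 ((mem_leftQuotient _ _).1 h)
      rcases List.append_eq_append_iff.1 hac with ⟨s, h1, h2⟩ | ⟨s, h1, h2⟩
      · right
        refine ⟨_, ⟨a, s, h1, ha, rfl⟩, ?_⟩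
        rw [mem_leftQuotient, ← h2]; exact hc
      · left
        refine Language.mem_mul.2 ⟨s, ?_, c, hc, h2.symm⟩
        rw [mem_leftQuotient, ← h1]; exact ha

theorem star_split {τ : Type*} {L : Language τ} (ls : List (List τ)) (hls : ∀ l ∈ ls, l ∈ L) :
    ∀ w y : List τ, w ≠ [] → w ++ y = ls.flatten →
      ∃ w1 w2 y1 y2, w = w1 ++ w2 ∧ y = y1 ++ y2 ∧ w1 ∈ KStar.kstar L ∧ w2 ++ y1 ∈ L ∧
        y2 ∈ KStar.kstar L := by
  induction ls with
  | nil => intro w y hw h; simp at h; exact absurd h.1 hw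
  | cons l ls ih =>
    intro w y hw h
    have hl : l ∈ L := hls l (by simp)
    have hr : ∀ l ∈ ls, l ∈ L := fun l h => hls l (by simp [h])
    have hrest : ls.flatten ∈ KStar.kstar L := Language.join_mem_kstar hr
    rw [List.flatten_cons] at h
    rcases List.append_eq_append_iff.1 h with ⟨s, h1, h2⟩ | ⟨s, h1, h2⟩
    · exact ⟨[], w, s, ls.flatten, rfl, h2, Language.nil_mem_kstar L, h1 ▸ hl, hrest⟩
    · by_cases hs : s = []
      · subst hs
        simp at h1 h2
        exact ⟨[], w, [], y, rfl, rfl, Language.nil_mem_kstar L, by simpa [h1] using hl, h2 ▸ hrest⟩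
      · obtain ⟨w1, w2, y1, y2, e1, e2, m1, m2, m3⟩ := ih hr s y hs h2.symm
        refine ⟨l ++ w1, w2, y1, y2, by simp [h1, e1], e2, ?_, m2, m3⟩
        obtain ⟨ks, rfl, hks⟩ := Language.mem_kstar.1 m1
        exact Language.mem_kstar.2 ⟨l :: ks, by simp, by simpa [hl] using hks⟩

theorem kstar_append {τ : Type*} {L : Language τ} {a b : List τ}
    (ha : a ∈ KStar.kstar L) (hb : b ∈ KStar.kstar L) : a ++ b ∈ KStar.kstar L := by
  obtain ⟨ks, rfl, hks⟩ := Language.mem_kstar.1 ha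
  obtain ⟨js, rfl, hjs⟩ := Language.mem_kstar.1 hb
  refine Language.mem_kstar.2 ⟨ks ++ js, by simp, ?_⟩
  intro y hy
  rcases List.mem_append.1 hy with h | h
  exacts [hks _ h, hjs _ h]

theorem star_regular {τ : Type*} {L : Language τ} (hL : L.IsRegular) :
    (KStar.kstar L : Language τ).IsRegular := by
  rw [isRegular_iff_finite_range_leftQuotient] at *
  have hfin := ((hL.powerset).image (fun (T : Set (Language τ)) =>
      ({y | ∃ B ∈ T, ∃ y1 y2, y = y1 ++ y2 ∧ y1 ∈ B ∧ y2 ∈ KStar.kstar L} : Language τ))).insert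
      (KStar.kstar L)
  refine hfin.subset ?_
  rintro _ ⟨w, rfl⟩
  by_cases hw : w = []
  · subst hw; left; rfl
  right
  refine ⟨{B | ∃ w1 w2, w = w1 ++ w2 ∧ w1 ∈ KStar.kstar L ∧ B = L.leftQuotient w2}, ?_, ?_⟩
  · rintro _ ⟨w1, w2, _, _, rfl⟩
    exact ⟨w2, rfl⟩
  · ext y
    constructor
    · rintro ⟨_, ⟨w1, w2, rfl, h1, rfl⟩, y1, y2, rfl, h2, h3⟩
      have hh : w2 ++ y1 ∈ KStar.kstar L :=
        Language.mem_kstar.2 ⟨[w2 ++ y1], by simp, by simpa using h2⟩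
      have := kstar_append (kstar_append h1 hh) h3
      have e : w1 ++ (w2 ++ y1) ++ y2 = (w1 ++ w2) ++ (y1 ++ y2) := by simp
      rw [e] at this
      exact this
    · intro h
      obtain ⟨ls, e, hls⟩ := Language.mem_kstar.1 ((mem_leftQuotient _ _).1 h)
      obtain ⟨w1, w2, y1, y2, e1, e2, m1, m2, m3⟩ := star_split ls hls w y hw e
      exact ⟨_, ⟨w1, w2, e1, m1, rfl⟩, y1, y2, e2, m2, m3⟩

theorem singleton_regular {τ : Type*} (u : List τ) : ({u} : Language τ).IsRegular := by
  rw [isRegular_iff_finite_range_leftQuotient]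
  have hfin : (insert (∅ : Set (List τ)) ((fun s => ({s} : Set (List τ))) '' {s | s ∈ u.tails})).Finite :=
    ((List.finite_toSet u.tails).image _).insert _
  refine Set.Finite.subset hfin ?_
  rintro _ ⟨w, rfl⟩
  by_cases h : ∃ s, w ++ s = u
  · obtain ⟨s, rfl⟩ := h
    right
    refine ⟨s, by simp, ?_⟩
    ext y
    change y = s ↔ w ++ y = w ++ s
    simp
  · left
    ext y
    change w ++ y = u ↔ False
    simp only [iff_false]
    exact fun hh => h ⟨y, hh⟩

theorem all_regular {τ : Type*} (P : τ → Prop) :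
    IsReg ({w | ∀ c ∈ w, P c} : Set (List τ)) := by
  rw [reg_iff]
  refine Set.Finite.subset (Set.toFinite {(∅ : Set (List τ)), {w | ∀ c ∈ w, P c}}) ?_
  rintro _ ⟨w, rfl⟩
  by_cases h : ∀ c ∈ w, P c
  · right
    ext y
    change (∀ c ∈ w ++ y, P c) ↔ (∀ c ∈ y, P c)
    simp only [List.mem_append]
    exact ⟨fun h' c hc => h' c (Or.inr hc), fun h' c hc => hc.elim (h c) (h' c)⟩
  · left
    ext y
    change (∀ c ∈ w ++ y, P c) ↔ False
    simp only [List.mem_append, iff_false]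
    exact fun h' => h fun c hc => h' c (Or.inl hc)

theorem preimage_regular {σ τ : Type*} (f : σ → Option τ) {L : Set (List τ)} (hL : IsReg L) :
    IsReg {q : List σ | q.filterMap f ∈ L} := by
  rw [reg_iff] at *
  refine (hL.image (fun B => ({q | q.filterMap f ∈ B} : Set (List σ)))).subset ?_
  rintro _ ⟨w, rfl⟩
  refine ⟨_, ⟨w.filterMap f, rfl⟩, ?_⟩
  ext y
  change w.filterMap f ++ y.filterMap f ∈ L ↔ (w ++ y).filterMap f ∈ L
  rw [List.filterMap_append]

theorem inter_regular {τ : Type*} {L M : Set (List τ)} (hL : IsReg L) (hM : IsReg M) :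
    IsReg {w | w ∈ L ∧ w ∈ M} := Language.IsRegular.inf hL hM

theorem union_regular {τ : Type*} {L M : Set (List τ)} (hL : IsReg L) (hM : IsReg M) :
    IsReg {w | w ∈ L ∨ w ∈ M} := Language.IsRegular.add hL hM

theorem avoid_regular {τ : Type*} (u : List τ) : IsReg {l : List τ | l ≠ [] ∧ ¬ u <:+: l} := by
  have htop : IsReg {w : List τ | ∀ c ∈ w, True} := all_regular _
  have h1 : IsReg ({w | u <:+: w} : Set (List τ)) := by
    have := mul_regular (mul_regular htop (singleton_regular u)) htop
    refine reg_congr this fun w => ?_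
    refine Iff.trans ?_ Language.mem_mul.symm
    constructor
    · rintro ⟨a, b, rfl⟩
      exact ⟨a ++ u, Language.mem_mul.2 ⟨a, fun _ _ => trivial, u, rfl, rfl⟩, b,
        fun _ _ => trivial, rfl⟩
    · rintro ⟨_, ha, b, _, rfl⟩
      obtain ⟨a, _, c, rfl, rfl⟩ := Language.mem_mul.1 ha
      exact ⟨a, b, rfl⟩
  exact inter_regular (Language.IsRegular.compl (singleton_regular []))
    (Language.IsRegular.compl h1)

theorem padR_append {τ : Type*} (p s t : List τ) :
    padR (p ++ s) (p ++ t) = p.map (fun a => (some a, some a)) ++ padR s t := by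
  induction p with
  | nil => rfl
  | cons a p ih =>
    simp only [padR, List.cons_append, List.map_cons, List.length_cons, Nat.add_sub_add_right,
      List.zip_cons_cons] at *
    rw [ih]

theorem padR_nil_left {τ : Type*} (t : List τ) :
    padR [] t = t.map (fun a => (none, some a)) := by
  induction t with
  | nil => rfl
  | cons a p ih =>
    simp [padR, List.replicate_succ] at *
    exact ih

theorem padR_nil_right {τ : Type*} (t : List τ) :
    padR t [] = t.map (fun a => (some a, none)) := by
  induction t with
  | nil => rfl
  | cons a p ih =>
    simp [padR, List.replicate_succ] at *
    exact ih

theorem padR_cons {τ : Type*} (a b : τ) (s t : List τ) :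
    padR (a :: s) (b :: t) = (some a, some b) :: padR s t := by
  simp [padR]

theorem padR_fst {τ : Type*} (s t : List τ) : (padR s t).filterMap Prod.fst = s := by
  induction s generalizing t with
  | nil => simp [padR_nil_left, List.filterMap_map]
  | cons a s ih =>
    cases t with
    | nil => simp [padR_nil_right, List.filterMap_map]
    | cons b t => simp [padR_cons, ih]

theorem padR_snd {τ : Type*} (s t : List τ) : (padR s t).filterMap Prod.snd = t := by
  induction s generalizing t with
  | nil => simp [padR_nil_left, List.filterMap_map]
  | cons a s ih =>
    cases t with
    | nil => simp [padR_nil_right, List.filterMap_map]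
    | cons b t => simp [padR_cons, ih]

theorem padR_self {τ : Type*} (s : List τ) :
    padR s s = s.map (fun a => (some a, some a)) := by
  have := padR_append s [] []
  simpa [padR] using this

theorem diag_regular (τ : Type*) :
    IsReg {q : List (Option τ × Option τ) | ∃ p : List τ, q = p.map (fun a => (some a, some a))} := by
  refine reg_congr (all_regular (fun c : Option τ × Option τ => ∃ a, c = (some a, some a))) fun q => ?_
  constructor
  · rintro ⟨p, rfl⟩ c hc
    obtain ⟨a, _, rfl⟩ := List.mem_map.1 hc
    exact ⟨a, rfl⟩
  · intro h
    induction q with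
    | nil => exact ⟨[], rfl⟩
    | cons c q ih =>
      obtain ⟨a, rfl⟩ := h c (by simp)
      obtain ⟨p, rfl⟩ := ih (fun d hd => h d (by simp [hd]))
      exact ⟨a :: p, rfl⟩

/-- Possible endings: `t` followed by the letter `b` reduces to the letter `c`. -/
def Tail {τ : Type*} (u : List τ) (x b : τ) (t : List τ) (c : τ) : Prop :=
  (t = [] ∧ c = b) ∨ ∃ v, v ++ [b] = u ∧ c = x ∧
    (t = v ∨ (b = x ∧ ∃ m, t = v ++ (List.replicate m v).flatten))

/-- The pairs `(w, z)` with `z` obtained from `w b` by reducing at the end. -/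
def Rel {τ : Type*} (u : List τ) (x b : τ) (w z : List τ) : Prop :=
  ∃ p t c, w = p ++ t ∧ z = p ++ [c] ∧ Tail u x b t c

theorem padR_tail {τ : Type*} (v s : List τ) (hv : v ≠ []) (c : τ) :
    padR (v ++ s) [c] = padR v [c] ++ s.map (fun a => (some a, none)) := by
  cases v with
  | nil => exact absurd rfl hv
  | cons a v => simp [padR_cons, padR_nil_right]

theorem tail_regular {τ : Type*} (u : List τ) (hu : 2 ≤ u.length) (x b : τ) :
    IsReg {q : List (Option τ × Option τ) | ∃ t c, Tail u x b t c ∧ q = padR t [c]} := by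
  have h0 : IsReg ({[(none, some b)]} : Set (List (Option τ × Option τ))) := singleton_regular _
  by_cases hv : ∃ v, v ++ [b] = u
  · obtain ⟨v, rfl⟩ := hv
    have hv : v ≠ [] := by rintro rfl; simp at hu
    have h1 : IsReg ({padR v [x]} : Set (List (Option τ × Option τ))) := singleton_regular _
    by_cases hb : b = x
    · subst hb
      have h2 := mul_regular h1 (star_regular (singleton_regular (v.map (fun a => (some a, (none : Option τ))))))
      refine reg_congr (union_regular h0 h2) fun q => ?_
      constructor
      · have key : ∀ m, padR (v ++ (List.replicate m v).flatten) [b] ∈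
            ({padR v [b]} : Language _) * KStar.kstar
            ({v.map (fun a => (some a, (none : Option τ)))} : Language _) := by
          intro m
          rw [padR_tail _ _ hv]
          refine Language.mem_mul.2 ⟨_, rfl, _, ?_, rfl⟩
          refine Language.mem_kstar.2 ⟨List.replicate m (v.map (fun a => (some a, none))), ?_, ?_⟩
          · simp [List.map_flatten]
          · intro y hy
            exact (List.mem_replicate.1 hy).2
        rintro ⟨t, c, (⟨rfl, rfl⟩ | ⟨v', hv', rfl, h⟩), rfl⟩
        · left; rfl
        · right
          have : v' = v := by simpa using hv'
          subst this
          rcases h with rfl | ⟨_, m, rfl⟩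
          · have := key 0
            simp only [List.replicate_zero, List.flatten_nil, List.append_nil] at this
            exact this
          · exact key m
      · rintro (h | h)
        · exact ⟨[], b, Or.inl ⟨rfl, rfl⟩, h⟩
        · obtain ⟨_, rfl, s, hs, rfl⟩ := Language.mem_mul.1 h
          obtain ⟨ks, rfl, hks⟩ := Language.mem_kstar.1 hs
          refine ⟨v ++ (List.replicate ks.length v).flatten, b,
            Or.inr ⟨v, rfl, rfl, Or.inr ⟨rfl, _, rfl⟩⟩, ?_⟩
          rw [padR_tail _ _ hv]
          have : ks = List.replicate ks.length (v.map (fun a => (some a, (none : Option τ)))) :=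
            List.eq_replicate_iff.2 ⟨rfl, hks⟩
          conv_lhs => rw [this]
          simp [List.map_flatten]
    · refine reg_congr (union_regular h0 h1) fun q => ?_
      constructor
      · rintro ⟨t, c, (⟨rfl, rfl⟩ | ⟨v', hv', rfl, h⟩), rfl⟩
        · left; rfl
        · right
          have : v' = v := by simpa using hv'
          subst this
          rcases h with rfl | ⟨h, _⟩
          · rfl
          · exact absurd h hb
      · rintro (h | h)
        · exact ⟨[], b, Or.inl ⟨rfl, rfl⟩, h⟩
        · exact ⟨v, x, Or.inr ⟨v, rfl, rfl, Or.inl rfl⟩, h⟩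
  · refine reg_congr (h0) fun q => ?_
    constructor
    · rintro ⟨t, c, (⟨rfl, rfl⟩ | ⟨v', hv', rfl, h⟩), rfl⟩
      · rfl
      · exact absurd ⟨v', hv'⟩ hv
    · intro h
      exact ⟨[], b, Or.inl ⟨rfl, rfl⟩, h⟩

theorem rel_regular {τ : Type*} (u : List τ) (hu : 2 ≤ u.length) (x b : τ) :
    IsReg {q : List (Option τ × Option τ) | ∃ w z, Rel u x b w z ∧ q = padR w z} := by
  refine reg_congr (mul_regular (diag_regular τ) (tail_regular u hu x b)) fun q => ?_
  refine Iff.trans ?_ Language.mem_mul.symm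
  constructor
  · rintro ⟨_, _, ⟨p, t, c, rfl, rfl, h⟩, rfl⟩
    exact ⟨_, ⟨p, rfl⟩, _, ⟨t, c, h, rfl⟩, (padR_append _ _ _).symm⟩
  · rintro ⟨_, ⟨p, rfl⟩, _, ⟨t, c, h, rfl⟩, rfl⟩
    exact ⟨_, _, ⟨p, t, c, rfl, rfl, h⟩, (padR_append _ _ _).symm⟩

theorem pow_eq {τ : Type*} (v p : List τ) (x : τ) (m : ℕ) :
    WordEq {(v ++ [x], [x])} (p ++ (List.replicate m v).flatten ++ [x]) (p ++ [x]) := by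
  induction m with
  | zero => simp only [List.replicate_zero, List.flatten_nil, List.append_nil]; exact Relation.EqvGen.refl _
  | succ m ih =>
    refine Relation.EqvGen.trans _ _ _ (Relation.EqvGen.rel _ _ ?_) ih
    refine ⟨p ++ (List.replicate m v).flatten, v ++ [x], [x], [], rfl, ?_, by simp⟩
    simp [List.replicate_succ']

theorem rel_eq {τ : Type*} {u : List τ} {x b : τ} {w z : List τ} (h : Rel u x b w z) :
    WordEq {(u, [x])} (w ++ [b]) z := by
  obtain ⟨p, t, c, rfl, rfl, (⟨rfl, rfl⟩ | ⟨v, rfl, rfl, rfl | ⟨rfl, m, rfl⟩⟩)⟩ := h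
  · rw [List.append_nil]; exact Relation.EqvGen.refl _
  · exact Relation.EqvGen.rel _ _ ⟨p, t ++ [b], [c], [], rfl, by simp, by simp⟩
  · have := pow_eq v p b (m + 1)
    simpa [List.replicate_succ] using this

theorem infix_snoc {τ : Type*} {u w : List τ} {b : τ} (hu : u ≠ []) (h : u <:+: w ++ [b])
    (hw : ¬ u <:+: w) : ∃ p v, u = v ++ [b] ∧ w = p ++ v := by
  obtain ⟨p, s, h⟩ := h
  rcases List.eq_nil_or_concat s with rfl | ⟨s, c, rfl⟩
  · rcases List.eq_nil_or_concat u with rfl | ⟨v, c, rfl⟩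
    · exact absurd rfl hu
    · have h' : (p ++ v) ++ [c] = w ++ [b] := by simpa using h
      obtain ⟨h1, h2⟩ := List.append_inj' h' rfl
      exact ⟨p, v, by simpa using h2, h1.symm⟩
  · have h' : (p ++ u ++ s) ++ [c] = w ++ [b] := by simpa using h
    obtain ⟨h1, h2⟩ := List.append_inj' h' rfl
    exact absurd ⟨p, s, h1⟩ hw

theorem rel_exists_x {τ : Type*} (u : List τ) (hu : 2 ≤ u.length) (x : τ) (n : ℕ) :
    ∀ w : List τ, w.length = n → ¬ u <:+: w → ∃ z, Rel u x x w z ∧ ¬ u <:+: z := by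
  induction n using Nat.strong_induction_on with
  | _ n ih =>
    intro w hn hw
    by_cases h : u <:+: w ++ [x]
    · have hu0 : u ≠ [] := by rintro rfl; simp at hu
      obtain ⟨p, v, rfl, rfl⟩ := infix_snoc hu0 h hw
      have hv : 1 ≤ v.length := by simpa using hu
      obtain ⟨z, ⟨p', t, c, rfl, rfl, ht⟩, hz⟩ := ih p.length (by
        rw [← hn, List.length_append]; omega) p rfl
        (fun h => hw (h.trans (List.infix_append' [] p v)))
      refine ⟨_, ⟨p', t ++ v, c, by simp, rfl, Or.inr ⟨v, rfl, ?_⟩⟩, hz⟩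
      rcases ht with ⟨rfl, rfl⟩ | ⟨v', hv', rfl, ht⟩
      · exact ⟨rfl, Or.inl rfl⟩
      · have : v' = v := by simpa using hv'
        subst this
        refine ⟨rfl, Or.inr ⟨rfl, ?_⟩⟩
        rcases ht with rfl | ⟨_, m, rfl⟩
        · exact ⟨1, by simp⟩
        · exact ⟨m + 1, by simp [List.replicate_succ']⟩
    · exact ⟨_, ⟨w, [], x, by simp, rfl, Or.inl ⟨rfl, rfl⟩⟩, h⟩

theorem rel_exists {τ : Type*} (u : List τ) (hu : 2 ≤ u.length) (x b : τ)
    (w : List τ) (hw : ¬ u <:+: w) : ∃ z, Rel u x b w z ∧ ¬ u <:+: z := by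
  by_cases hb : b = x
  · subst hb
    exact rel_exists_x u hu b _ w rfl hw
  by_cases h : u <:+: w ++ [b]
  · have hu0 : u ≠ [] := by rintro rfl; simp at hu
    obtain ⟨p, v, rfl, rfl⟩ := infix_snoc hu0 h hw
    refine ⟨_, ⟨p, v, x, rfl, rfl, Or.inr ⟨v, rfl, rfl, Or.inl rfl⟩⟩, ?_⟩
    intro h2
    obtain ⟨p', v', h3, h4⟩ := infix_snoc hu0 h2
      (fun h => hw (h.trans (List.infix_append' [] p v)))
    exact hb (by simpa using (List.append_inj' h3 rfl).2)
  · exact ⟨_, ⟨w, [], b, by simp, rfl, Or.inl ⟨rfl, rfl⟩⟩, h⟩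

theorem wordEq_nil {τ : Type*} (u : List τ) (hu : u ≠ []) (x : τ) {a b : List τ}
    (h : WordEq {(u, [x])} a b) : a = [] ↔ b = [] := by
  induction h with
  | rel a b h =>
    obtain ⟨p, u', v', s, h, rfl, rfl⟩ := h
    obtain ⟨rfl, rfl⟩ := Prod.mk.inj h
    simp [hu]
  | refl => rfl
  | symm _ _ _ ih => exact ih.symm
  | trans _ _ _ _ _ ih1 ih2 => exact ih1.trans ih2

theorem expandW_single {τ : Type*} (w : List τ) : expandW (fun a => [a]) w = w := by
  induction w with
  | nil => rfl
  | cons a w ih => simpa [expandW] using ih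

end St6

/-- let `S = sgp⁺⟨α ∣ u = x⟩` with `|u| = k ≥ 2` and `x` a single
letter, where `{u = x}` is a Gröbner–Shirshov basis.  Then `S` is
prefix-automatic. -/
theorem statement_6 {α : Type} [Fintype α] (k : ℕ) (hk : 2 ≤ k)
    (u : List α) (hu : u.length = k) (x : α)
    (R : Set (List α × List α)) (hRdef : R = {(u, [x])})
    (hGSB : ∀ w : List α, w ≠ [] →
      ∃! l : List α, (l ≠ [] ∧ ¬ u <:+: l) ∧ WordEq R l w) :
    SgpPrefixAutomatic R := by
  subst hRdef
  have hu2 : 2 ≤ u.length := hu ▸ hk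
  have hu0 : u ≠ [] := by rintro rfl; simp at hu2
  have hLreg := St6.avoid_regular u
  have huniq : ∀ a b : List α, (a ≠ [] ∧ ¬ u <:+: a) → (b ≠ [] ∧ ¬ u <:+: b) →
      WordEq {(u, [x])} a b → a = b := by
    intro a b ha hb hab
    exact (hGSB b hb.1).unique ⟨ha, hab⟩ ⟨hb, Relation.EqvGen.refl _⟩
  have heq : IsReg {p | ∃ y ∈ {l : List α | l ≠ [] ∧ ¬ u <:+: l}, p = padR y y} := by
    refine St6.reg_congr (St6.inter_regular (St6.diag_regular α) (St6.preimage_regular Prod.fst hLreg)) fun q => ?_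
    constructor
    · rintro ⟨y, hy, rfl⟩
      refine ⟨⟨y, St6.padR_self y⟩, ?_⟩
      change (padR y y).filterMap Prod.fst ∈ {l : List α | l ≠ [] ∧ ¬ u <:+: l}
      rwa [St6.padR_fst]
    · rintro ⟨⟨y, rfl⟩, h⟩
      rw [← St6.padR_self] at h ⊢
      change (padR y y).filterMap Prod.fst ∈ {l : List α | l ≠ [] ∧ ¬ u <:+: l} at h
      rw [St6.padR_fst] at h
      exact ⟨y, h, rfl⟩
  refine ⟨α, inferInstance, fun a => [a], {l | l ≠ [] ∧ ¬ u <:+: l}, ?_⟩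
  refine ⟨⟨by simp, hLreg, fun w hw => hw.1, ?_, ?_, ?_⟩, ?_⟩
  · intro w hw
    obtain ⟨l, ⟨hl, h⟩, _⟩ := hGSB w hw
    exact ⟨l, hl, by rwa [St6.expandW_single]⟩
  · refine St6.reg_congr (heq) fun q => ?_
    simp only [St6.expandW_single]
    constructor
    · rintro ⟨y, hy, z, hz, h, rfl⟩
      obtain rfl := huniq y z hy hz h
      exact ⟨y, hy, rfl⟩
    · rintro ⟨y, hy, rfl⟩
      exact ⟨y, hy, y, hy, Relation.EqvGen.refl _, rfl⟩
  · intro b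
    refine St6.reg_congr (St6.inter_regular (St6.rel_regular u hu2 x b)
      (St6.inter_regular (St6.preimage_regular Prod.fst hLreg)
        (St6.preimage_regular Prod.snd hLreg))) fun q => ?_
    simp only [St6.expandW_single]
    constructor
    · rintro ⟨y, hy, z, hz, h, rfl⟩
      obtain ⟨z', hz', hav⟩ := St6.rel_exists u hu2 x b y hy.2
      have hne : z' ≠ [] := by
        obtain ⟨p, t, c, _, rfl, _⟩ := hz'
        simp
      obtain rfl := huniq z z' hz ⟨hne, hav⟩
        (Relation.EqvGen.trans _ _ _ (Relation.EqvGen.symm _ _ h) (St6.rel_eq hz'))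
      refine ⟨⟨y, z, hz', rfl⟩, ?_, ?_⟩
      · change (padR y z).filterMap Prod.fst ∈ {l : List α | l ≠ [] ∧ ¬ u <:+: l}
        rwa [St6.padR_fst]
      · change (padR y z).filterMap Prod.snd ∈ {l : List α | l ≠ [] ∧ ¬ u <:+: l}
        rwa [St6.padR_snd]
    · rintro ⟨⟨y, z, hyz, rfl⟩, h1, h2⟩
      change (padR y z).filterMap Prod.fst ∈ {l : List α | l ≠ [] ∧ ¬ u <:+: l} at h1
      change (padR y z).filterMap Prod.snd ∈ {l : List α | l ≠ [] ∧ ¬ u <:+: l} at h2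
      rw [St6.padR_fst] at h1
      rw [St6.padR_snd] at h2
      exact ⟨y, h1, z, h2, St6.rel_eq hyz, rfl⟩
  · refine St6.reg_congr (heq) fun q => ?_
    simp only [St6.expandW_single]
    constructor
    · rintro ⟨y, hy, z, ⟨z', hz', hpre⟩, h, rfl⟩
      have hz0 : z ≠ [] := fun hz0 => hy.1 ((St6.wordEq_nil u hu0 x h).2 hz0)
      obtain rfl := huniq y z hy ⟨hz0, fun hh => hz'.2 (hh.trans hpre.isInfix)⟩ h
      exact ⟨y, hy, rfl⟩
    · rintro ⟨y, hy, rfl⟩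
      exact ⟨y, hy, y, ⟨y, hy, List.prefix_rfl⟩, Relation.EqvGen.refl _, rfl⟩
end
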